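/- arXiv:2405.04385 — 3 statements merged into one kernel-verified Lean document; each statement's English description precedes it below -/
import Mathlib

section
/- Let α ∈ {−1/d : d ∈ ℕ, d ≥ 2} ∪ [0,∞). There exist constants B > 1 and c_{α,1} > 0, depending only on α, such that for every q ∈ (0,1] and every very simple increasing color-difference process (Δ(n))_{n≥1} with parameters (α, q), setting A := q^{−1/4}: liminf_{N→∞} μ( Δ₁(N) > 0 ∣ {τ_high(A) ≤ N} ∩ {τ_low(B) > N} ) ≥ 1 − c_{α,1}·√q, where μ(· ∣ E) denotes conditional probability given the event E. -/
open MeasureTheory Filter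
open scoped ENat


/-- Normalisation `Z_α(n) = α(1 - 1/n) + 1` for very simple increasing trees. -/
noncomputable def Zvs (α : ℝ) (n : ℕ) : ℝ := α * (1 - 1 / (n : ℝ)) + 1

/-- `p(n, x₁, x₂) = (1/2)(1 + (x₁ + α x₂)/(Z_α(n) n))`, the probability that the new vertex
attaches to a red vertex. -/
noncomputable def pvs (α : ℝ) (n : ℕ) (x₁ x₂ : ℤ) : ℝ :=
  (1 / 2) * (1 + ((x₁ : ℝ) + α * (x₂ : ℝ)) / (Zvs α n * (n : ℝ)))

/-- The set of allowed parameters `α ∈ {-1/d : d ∈ ℕ, d ≥ 2} ∪ [0, ∞)` for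
very simple increasing trees. -/
def vsiAllowed : Set ℝ := {x : ℝ | ∃ d : ℕ, 2 ≤ d ∧ x = -1 / (d : ℝ)} ∪ Set.Ici (0 : ℝ)

/-- A very simple increasing (v.s.i.) color-difference process with parameters `(α, q)` on the
measurable space `Ω`: a probability measure `μ`, a filtration `F`, and an adapted `ℤ²`-valued
process `Δ` with `Δ(1) = (1,0)`, whose increments `D(n) = Δ(n+1) - Δ(n)` are
`F(n+1)`-measurable with values in `{(1,1), (-1,1), (1,-1), (-1,-1)}`, and whose conditional
probabilities given `F n` (conditional expectations of indicator functions) are as prescribed. -/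
structure VSIProcess (α q : ℝ) (Ω : Type) [mΩ : MeasurableSpace Ω] where
  μ : Measure Ω
  isProb : IsProbabilityMeasure μ
  F : ℕ → MeasurableSpace Ω
  F_le : ∀ n, F n ≤ mΩ
  F_mono : Monotone F
  Δ : ℕ → Ω → ℤ × ℤ
  adapted : ∀ n, 1 ≤ n → @Measurable Ω (ℤ × ℤ) (F n) _ (Δ n)
  init : ∀ ω, Δ 1 ω = (1, 0)
  D_meas : ∀ n, 1 ≤ n → @Measurable Ω (ℤ × ℤ) (F (n + 1)) _ (fun ω => Δ (n + 1) ω - Δ n ω)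
  D_range : ∀ n, 1 ≤ n → ∀ ω,
    Δ (n + 1) ω - Δ n ω ∈ ({(1, 1), (-1, 1), (1, -1), (-1, -1)} : Set (ℤ × ℤ))
  cond_rr : ∀ n, 1 ≤ n →
    μ[Set.indicator {ω | Δ (n + 1) ω - Δ n ω = (1, 1)} (fun _ => (1 : ℝ)) | F n]
      =ᵐ[μ] fun ω => pvs α n (Δ n ω).1 (Δ n ω).2 * (1 - q)
  cond_br : ∀ n, 1 ≤ n →
    μ[Set.indicator {ω | Δ (n + 1) ω - Δ n ω = (-1, 1)} (fun _ => (1 : ℝ)) | F n]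
      =ᵐ[μ] fun ω => pvs α n (Δ n ω).1 (Δ n ω).2 * q
  cond_rb : ∀ n, 1 ≤ n →
    μ[Set.indicator {ω | Δ (n + 1) ω - Δ n ω = (1, -1)} (fun _ => (1 : ℝ)) | F n]
      =ᵐ[μ] fun ω => (1 - pvs α n (Δ n ω).1 (Δ n ω).2) * q
  cond_bb : ∀ n, 1 ≤ n →
    μ[Set.indicator {ω | Δ (n + 1) ω - Δ n ω = (-1, -1)} (fun _ => (1 : ℝ)) | F n]
      =ᵐ[μ] fun ω => (1 - pvs α n (Δ n ω).1 (Δ n ω).2) * (1 - q)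

/-- `τ_high(A) = inf {n ≥ 1 : Δ₁(n) + α Δ₂(n) > A Z_α(n) √n}`, with value `∞` if no such `n`
exists. -/
noncomputable def tauHigh {α q : ℝ} {Ω : Type} [MeasurableSpace Ω]
    (P : VSIProcess α q Ω) (A : ℝ) (ω : Ω) : ℕ∞ :=
  sInf {N : ℕ∞ | ∃ n : ℕ, N = (n : ℕ∞) ∧ 1 ≤ n ∧
    A * Zvs α n * Real.sqrt n < ((P.Δ n ω).1 : ℝ) + α * ((P.Δ n ω).2 : ℝ)}

/-- `τ_low(B) = inf {n > τ_high(A) : Δ₁(n) + α Δ₂(n) ≤ B Z_α(n) √n}`, with value `∞` if no such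
`n` exists. -/
noncomputable def tauLow {α q : ℝ} {Ω : Type} [MeasurableSpace Ω]
    (P : VSIProcess α q Ω) (A B : ℝ) (ω : Ω) : ℕ∞ :=
  sInf {N : ℕ∞ | ∃ n : ℕ, N = (n : ℕ∞) ∧ tauHigh P A ω < (n : ℕ∞) ∧
    ((P.Δ n ω).1 : ℝ) + α * ((P.Δ n ω).2 : ℝ) ≤ B * Zvs α n * Real.sqrt n}

namespace VSI

lemma integrable_bdd {Ω : Type} {mΩ : MeasurableSpace Ω} {μ : Measure Ω} [IsProbabilityMeasure μ]
    {g : Ω → ℝ} (hg : Measurable g) (hb : ∃ C : ℝ, ∀ ω, |g ω| ≤ C) : Integrable g μ := by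
  obtain ⟨C, hC⟩ := hb
  exact Integrable.of_bound hg.aestronglyMeasurable C
    (Filter.Eventually.of_forall (fun ω => by simpa using hC ω))

lemma bdd_mul {Ω : Type} {f g : Ω → ℝ} (hf : ∃ C : ℝ, ∀ ω, |f ω| ≤ C)
    (hg : ∃ C : ℝ, ∀ ω, |g ω| ≤ C) : ∃ C : ℝ, ∀ ω, |f ω * g ω| ≤ C := by
  obtain ⟨C, hC⟩ := hf
  obtain ⟨D, hD⟩ := hg
  refine ⟨C * D, fun ω => ?_⟩
  rw [abs_mul]
  exact mul_le_mul (hC ω) (hD ω) (abs_nonneg _) ((abs_nonneg _).trans (hC ω))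

lemma bdd_sub {Ω : Type} {f g : Ω → ℝ} (hf : ∃ C : ℝ, ∀ ω, |f ω| ≤ C)
    (hg : ∃ C : ℝ, ∀ ω, |g ω| ≤ C) : ∃ C : ℝ, ∀ ω, |f ω - g ω| ≤ C := by
  obtain ⟨C, hC⟩ := hf
  obtain ⟨D, hD⟩ := hg
  exact ⟨C + D, fun ω => (abs_sub _ _).trans (add_le_add (hC ω) (hD ω))⟩

lemma bdd_const {Ω : Type} (c : ℝ) : ∃ C : ℝ, ∀ _ω : Ω, |c| ≤ C := ⟨|c|, fun _ => le_rfl⟩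

lemma bdd_ind {Ω : Type} (s : Set Ω) : ∃ C : ℝ, ∀ ω, |s.indicator (fun _ => (1 : ℝ)) ω| ≤ C := by
  refine ⟨1, fun ω => ?_⟩
  by_cases h : ω ∈ s <;> simp [h]

section L2

variable {Ω : Type} {mΩ : MeasurableSpace Ω} {μ : Measure Ω} [IsProbabilityMeasure μ]
  {G : Filtration ℕ mΩ} {Y : ℕ → Ω → ℝ}

lemma L2_cross (hY : ∀ i, Measurable[G i] (Y i)) (hb : ∀ i, ∃ C : ℝ, ∀ ω, |Y i ω| ≤ C)
    (hm : ∀ i (g : Ω → ℝ), Measurable[G i] g → (∃ C : ℝ, ∀ ω, |g ω| ≤ C) →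
      ∫ ω, g ω * (Y (i + 1) ω - Y i ω) ∂μ = 0)
    (i : ℕ) (g : Ω → ℝ) (hg : Measurable[G i] g) (hgb : ∃ C : ℝ, ∀ ω, |g ω| ≤ C) :
    ∫ ω, g ω * (Y (i + 1) ω * Y (i + 1) ω) ∂μ
      = ∫ ω, g ω * (Y i ω * Y i ω) ∂μ
        + ∫ ω, g ω * ((Y (i + 1) ω - Y i ω) * (Y (i + 1) ω - Y i ω)) ∂μ := by
  have hg' : Measurable g := hg.mono (G.le i) le_rfl
  have hYi : ∀ i, Measurable (Y i) := fun i => (hY i).mono (G.le i) le_rfl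
  have h0 := hm i (fun ω => g ω * Y i ω) (hg.mul (hY i)) (bdd_mul hgb (hb i))
  have e : ∀ ω, g ω * (Y (i + 1) ω * Y (i + 1) ω)
      = (g ω * (Y i ω * Y i ω) + g ω * ((Y (i + 1) ω - Y i ω) * (Y (i + 1) ω - Y i ω)))
        + 2 * (g ω * Y i ω * (Y (i + 1) ω - Y i ω)) := fun ω => by ring
  have hd : Measurable (fun ω => Y (i + 1) ω - Y i ω) := (hYi _).sub (hYi _)
  have i1 : Integrable (fun ω => g ω * (Y i ω * Y i ω)) μ :=
    integrable_bdd (hg'.mul ((hYi i).mul (hYi i))) (bdd_mul hgb (bdd_mul (hb i) (hb i)))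
  have i2 : Integrable (fun ω => g ω * ((Y (i + 1) ω - Y i ω) * (Y (i + 1) ω - Y i ω))) μ :=
    integrable_bdd (hg'.mul (hd.mul hd)) (bdd_mul hgb
      (bdd_mul (bdd_sub (hb _) (hb _)) (bdd_sub (hb _) (hb _))))
  have i3 : Integrable (fun ω => 2 * (g ω * Y i ω * (Y (i + 1) ω - Y i ω))) μ :=
    (integrable_bdd ((hg'.mul (hYi i)).mul hd)
      (bdd_mul (bdd_mul hgb (hb _)) (bdd_sub (hb _) (hb _)))).const_mul 2
  simp_rw [e]
  have i12 : Integrable (fun ω => g ω * (Y i ω * Y i ω)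
      + g ω * ((Y (i + 1) ω - Y i ω) * (Y (i + 1) ω - Y i ω))) μ := i1.add i2
  rw [integral_add i12 i3, integral_add i1 i2, integral_const_mul, h0]
  ring

lemma L2_sum (hY : ∀ i, Measurable[G i] (Y i)) (hb : ∀ i, ∃ C : ℝ, ∀ ω, |Y i ω| ≤ C)
    (hm : ∀ i (g : Ω → ℝ), Measurable[G i] g → (∃ C : ℝ, ∀ ω, |g ω| ≤ C) →
      ∫ ω, g ω * (Y (i + 1) ω - Y i ω) ∂μ = 0)
    (r : ℕ → ℝ) (h0 : ∫ ω, Y 0 ω * Y 0 ω ∂μ ≤ r 0)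
    (hv : ∀ i, ∫ ω, (Y (i + 1) ω - Y i ω) * (Y (i + 1) ω - Y i ω) ∂μ ≤ r (i + 1) - r i) (n : ℕ) :
    ∫ ω, Y n ω * Y n ω ∂μ ≤ r n := by
  induction n with
  | zero => exact h0
  | succ n ih =>
    have := L2_cross hY hb hm n (fun _ => 1) measurable_const (bdd_const 1)
    simp only [one_mul] at this
    linarith [hv n]

lemma L2_max (hY : ∀ i, Measurable[G i] (Y i)) (hb : ∀ i, ∃ C : ℝ, ∀ ω, |Y i ω| ≤ C)
    (hm : ∀ i (g : Ω → ℝ), Measurable[G i] g → (∃ C : ℝ, ∀ ω, |g ω| ≤ C) →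
      ∫ ω, g ω * (Y (i + 1) ω - Y i ω) ∂μ = 0) (n : ℕ) (l : ℝ) (hl : 0 < l) :
    l ^ 2 * μ.real {ω | ∃ i ≤ n, l ≤ |Y i ω|} ≤ ∫ ω, Y n ω * Y n ω ∂μ := by
  have hYi : ∀ i, Measurable (Y i) := fun i => (hY i).mono (G.le i) le_rfl
  have hYintg : ∀ i, Integrable (fun ω => Y i ω * Y i ω) μ := fun i =>
    integrable_bdd ((hYi i).mul (hYi i)) (bdd_mul (hb i) (hb i))
  have hsub : Submartingale (fun i ω => Y i ω * Y i ω) G μ := by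
    refine submartingale_of_setIntegral_le_succ
      (fun i => ((hY i).mul (hY i)).stronglyMeasurable) hYintg ?_
    intro i s hs
    have hs' : MeasurableSet s := G.le i _ hs
    have := L2_cross hY hb hm i (s.indicator (fun _ => 1))
      (measurable_const.indicator hs) (bdd_ind s)
    have e : ∀ f : Ω → ℝ, ∫ ω in s, f ω ∂μ = ∫ ω, s.indicator (fun _ => (1 : ℝ)) ω * f ω ∂μ := by
      intro f
      rw [← integral_indicator hs']
      congr 1
      ext ω
      by_cases h : ω ∈ s <;> simp [h]
    rw [e, e, this]
    have : 0 ≤ ∫ ω, s.indicator (fun _ => (1 : ℝ)) ω *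
        ((Y (i + 1) ω - Y i ω) * (Y (i + 1) ω - Y i ω)) ∂μ := by
      apply integral_nonneg
      intro ω
      exact mul_nonneg (Set.indicator_nonneg (fun _ _ => zero_le_one) _) (mul_self_nonneg _)
    linarith
  have hmax := maximal_ineq hsub (fun i ω => mul_self_nonneg _)
    (ε := ⟨l ^ 2, by positivity⟩) n
  set T := {ω | ((⟨l ^ 2, by positivity⟩ : NNReal) : ℝ) ≤
    (Finset.range (n + 1)).sup' Finset.nonempty_range_add_one fun k => Y k ω * Y k ω} with hT
  have hTeq : {ω | ∃ i ≤ n, l ≤ |Y i ω|} = T := by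
    ext ω
    simp only [hT, Set.mem_ofPred_eq, Finset.le_sup'_iff, Finset.mem_range]
    constructor
    · rintro ⟨i, hi, h⟩
      exact ⟨i, by omega, by
        show l ^ 2 ≤ _
        rw [← abs_mul_abs_self (Y i ω)]; nlinarith [abs_nonneg (Y i ω)]⟩
    · rintro ⟨i, hi, h⟩
      refine ⟨i, by omega, ?_⟩
      have h : l ^ 2 ≤ Y i ω * Y i ω := h
      rw [← abs_mul_abs_self (Y i ω)] at h
      by_contra hh
      push Not at hh
      nlinarith [abs_nonneg (Y i ω)]
  rw [hTeq]
  have h2 : ∫ ω in T, Y n ω * Y n ω ∂μ ≤ ∫ ω, Y n ω * Y n ω ∂μ :=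
    setIntegral_le_integral (hYintg n) (Filter.Eventually.of_forall fun ω => mul_self_nonneg _)
  have h3 := ENNReal.toReal_mono (by simp) hmax
  rw [ENNReal.toReal_mul, ENNReal.toReal_ofReal (setIntegral_nonneg_of_ae
    (Filter.Eventually.of_forall fun ω => mul_self_nonneg _))] at h3
  refine le_trans ?_ h2
  exact h3

end L2

section seqs

/-- `z_n = Z_α(n) n`. -/
noncomputable def zz (α : ℝ) (n : ℕ) : ℝ := (1 + α) * n - α

/-- The normalisation making `S(n)` a martingale. -/
noncomputable def aa (α q : ℝ) (n : ℕ) : ℝ :=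
  ∏ i ∈ Finset.Ico 1 n, (1 + (1 + α - 2 * q) / zz α i)

variable {α q : ℝ}

lemma zz_ge (hα : -1 / 2 ≤ α) {n : ℕ} (hn : 1 ≤ n) : (n : ℝ) / 2 ≤ zz α n := by
  have : (1 : ℝ) ≤ n := by exact_mod_cast hn
  unfold zz
  nlinarith

lemma zz_pos (hα : -1 / 2 ≤ α) {n : ℕ} (hn : 1 ≤ n) : 0 < zz α n := by
  have : (1 : ℝ) ≤ n := by exact_mod_cast hn
  linarith [zz_ge hα hn]

lemma zz_succ (n : ℕ) : zz α (n + 1) = zz α n + (1 + α) := by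
  unfold zz; push_cast; ring

lemma Zvs_mul {n : ℕ} (hn : 1 ≤ n) : Zvs α n * n = zz α n := by
  have : (n : ℝ) ≠ 0 := by positivity
  unfold Zvs zz
  field_simp
  ring

lemma Zvs_ge (hα : -1 / 2 ≤ α) {n : ℕ} (hn : 1 ≤ n) : 1 / 2 ≤ Zvs α n := by
  have h := zz_ge hα hn
  rw [← Zvs_mul hn] at h
  have : (1 : ℝ) ≤ n := by exact_mod_cast hn
  by_contra hh
  push Not at hh
  nlinarith

lemma Zvs_le {n : ℕ} (hn : 1 ≤ n) : Zvs α n ≤ 1 + |α| := by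
  have h1 : (1 : ℝ) ≤ n := by exact_mod_cast hn
  have h2 : 0 ≤ 1 - 1 / (n : ℝ) := by
    rw [sub_nonneg, div_le_one (by linarith)]; exact h1
  have h3 : 1 - 1 / (n : ℝ) ≤ 1 := by
    have : 0 ≤ 1 / (n : ℝ) := by positivity
    linarith
  unfold Zvs
  nlinarith [le_abs_self α, abs_nonneg α, mul_le_mul_of_nonneg_right (le_abs_self α) h2,
    mul_le_mul_of_nonneg_left h3 (abs_nonneg α)]

lemma aa_one : aa α q 1 = 1 := by simp [aa]

lemma aa_succ {n : ℕ} (hn : 1 ≤ n) :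
    aa α q (n + 1) = aa α q n * (1 + (1 + α - 2 * q) / zz α n) := by
  unfold aa
  rw [Finset.prod_Ico_succ_top hn]

lemma fac_pos (hα : -1 / 2 ≤ α) (hq : q ≤ 1 / 16) {n : ℕ} (hn : 1 ≤ n) :
    0 < 1 + (1 + α - 2 * q) / zz α n := by
  have h1 : 0 ≤ (1 + α - 2 * q) / zz α n := div_nonneg (by linarith) (zz_pos hα hn).le
  linarith

lemma aa_pos (hα : -1 / 2 ≤ α) (hq : q ≤ 1 / 16) (n : ℕ) : 0 < aa α q n := by
  unfold aa
  apply Finset.prod_pos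
  intro i hi
  exact fac_pos hα hq (Finset.mem_Ico.1 hi).1

lemma key_step (hα : -1 / 2 ≤ α) (hq : q ≤ 1 / 16) {n : ℕ} (hn : 1 ≤ n) :
    (zz α (n + 1) + 1 / 4) * aa α q n ^ 2 ≤ zz α n * aa α q (n + 1) ^ 2 := by
  have hz := zz_pos hα hn
  have ha := aa_pos hα hq n
  rw [aa_succ hn, zz_succ]
  have e : zz α n * (aa α q n * (1 + (1 + α - 2 * q) / zz α n)) ^ 2
      = (zz α n + 2 * (1 + α - 2 * q) + (1 + α - 2 * q) ^ 2 / zz α n) * aa α q n ^ 2 := by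
    field_simp
    ring
  rw [e]
  apply mul_le_mul_of_nonneg_right _ (by positivity)
  have : 0 ≤ (1 + α - 2 * q) ^ 2 / zz α n := by positivity
  linarith

lemma r_step (hα : -1 / 2 ≤ α) (hq : q ≤ 1 / 16) {n : ℕ} (hn : 1 ≤ n) :
    1 / aa α q (n + 1) ^ 2
      ≤ 4 * (zz α n / aa α q n ^ 2) - 4 * (zz α (n + 1) / aa α q (n + 1) ^ 2) := by
  have h := key_step hα hq hn
  have ha := aa_pos hα hq n
  have ha' := aa_pos hα hq (n + 1)
  have h2 : (zz α (n + 1) + 1 / 4) / aa α q (n + 1) ^ 2 ≤ zz α n / aa α q n ^ 2 := by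
    rw [div_le_div_iff₀ (by positivity) (by positivity)]
    exact h
  rw [add_div] at h2
  have : (1 / 4 : ℝ) / aa α q (n + 1) ^ 2 = 1 / 4 * (1 / aa α q (n + 1) ^ 2) := by ring
  linarith

lemma ratio_mono (hα : -1 / 2 ≤ α) (hq : q ≤ 1 / 16) {k n : ℕ} (hk : 1 ≤ k) (hkn : k ≤ n) :
    zz α n / aa α q n ^ 2 ≤ zz α k / aa α q k ^ 2 := by
  induction n, hkn using Nat.le_induction with
  | base => exact le_rfl
  | succ n hn ih =>
    have h1 := r_step hα hq (hk.trans hn)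
    have h2 : 0 ≤ 1 / aa α q (n + 1) ^ 2 := by positivity
    linarith

lemma fourth (hα : -1 / 2 ≤ α) (hq : q ≤ 1 / 16) {n : ℕ} (hn : 1 ≤ n) :
    zz α n ^ 3 ≤ aa α q n ^ 4 := by
  induction n, hn using Nat.le_induction with
  | base => simp [aa_one, zz]
  | succ n hn ih =>
    have hz := zz_pos hα hn
    have ha := aa_pos hα hq n
    rw [aa_succ hn, zz_succ, mul_pow]
    set x := (1 + α) / zz α n with hx
    have hx0 : 0 ≤ x := div_nonneg (by linarith) hz.le
    have e1 : zz α n + (1 + α) = zz α n * (1 + x) := by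
      rw [hx]; field_simp
    have h1 : 3 / 4 * x ≤ (1 + α - 2 * q) / zz α n := by
      rw [hx, ← mul_div_assoc]
      apply div_le_div_of_nonneg_right _ hz.le
      linarith
    rw [e1, mul_pow]
    have h2 : (1 + x) ^ 3 ≤ (1 + 3 / 4 * x) ^ 4 := by
      have : (1 + 3 / 4 * x) ^ 4 - (1 + x) ^ 3
        = 3 / 8 * x ^ 2 + 11 / 16 * x ^ 3 + 81 / 256 * x ^ 4 := by ring
      have : 0 ≤ 3 / 8 * x ^ 2 + 11 / 16 * x ^ 3 + 81 / 256 * x ^ 4 := by positivity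
      linarith
    have h3 : (1 + 3 / 4 * x) ^ 4 ≤ (1 + (1 + α - 2 * q) / zz α n) ^ 4 :=
      pow_le_pow_left₀ (by positivity) (by linarith) 4
    exact mul_le_mul ih (h2.trans h3) (by positivity) (by positivity)

end seqs

section proc

variable {α q : ℝ} {Ω : Type} [mΩ : MeasurableSpace Ω] (P : VSIProcess α q Ω)

/-- The weighted colour difference. -/
noncomputable def S (n : ℕ) (ω : Ω) : ℝ := ((P.Δ n ω).1 : ℝ) + α * ((P.Δ n ω).2 : ℝ)

/-- The second martingale. -/
noncomputable def M (n : ℕ) (ω : Ω) : ℝ := ((P.Δ n ω).1 : ℝ) - (1 - 2 * q) * ((P.Δ n ω).2 : ℝ)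

lemma meas_comp {n : ℕ} (hn : 1 ≤ n) (f : ℤ × ℤ → ℝ) :
    Measurable[P.F n] (fun ω => f (P.Δ n ω)) :=
  (Measurable.of_discrete (f := f)).comp (P.adapted n hn)

lemma S_meas {n : ℕ} (hn : 1 ≤ n) : Measurable[P.F n] (S P n) :=
  meas_comp P hn (fun x => (x.1 : ℝ) + α * x.2)

lemma M_meas {n : ℕ} (hn : 1 ≤ n) : Measurable[P.F n] (M P n) :=
  meas_comp P hn (fun x => (x.1 : ℝ) - (1 - 2 * q) * x.2)

lemma delta_bdd {n : ℕ} (hn : 1 ≤ n) : ∀ ω, |(P.Δ n ω).1| ≤ n ∧ |(P.Δ n ω).2| ≤ n := by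
  induction n, hn using Nat.le_induction with
  | base => intro ω; simp [P.init]
  | succ n hn ih =>
    intro ω
    have h := P.D_range n hn ω
    obtain ⟨h1, h2⟩ := ih ω
    simp only [Set.mem_insert_iff, Set.mem_singleton_iff, Prod.ext_iff, Prod.fst_sub,
      Prod.snd_sub] at h
    rw [abs_le] at h1 h2 ⊢
    rw [abs_le]
    push_cast
    omega

lemma comp_bdd {n : ℕ} (hn : 1 ≤ n) (f : ℤ × ℤ → ℝ) : ∃ C : ℝ, ∀ ω, |f (P.Δ n ω)| ≤ C := by
  have hfin : (Set.Icc (-(n : ℤ)) n ×ˢ Set.Icc (-(n : ℤ)) n).Finite :=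
    (Set.finite_Icc _ _).prod (Set.finite_Icc _ _)
  obtain ⟨C, hC⟩ := (hfin.image (fun x => |f x|)).bddAbove
  refine ⟨C, fun ω => hC ⟨P.Δ n ω, ?_, rfl⟩⟩
  have := delta_bdd P hn ω
  rw [abs_le, abs_le] at this
  exact ⟨⟨this.1.1, this.1.2⟩, ⟨this.2.1, this.2.2⟩⟩

lemma S_bdd {n : ℕ} (hn : 1 ≤ n) : ∃ C : ℝ, ∀ ω, |S P n ω| ≤ C :=
  comp_bdd P hn (fun x => (x.1 : ℝ) + α * x.2)

lemma M_bdd {n : ℕ} (hn : 1 ≤ n) : ∃ C : ℝ, ∀ ω, |M P n ω| ≤ C :=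
  comp_bdd P hn (fun x => (x.1 : ℝ) - (1 - 2 * q) * x.2)

lemma single {n : ℕ} (hn : 1 ≤ n) (d : ℤ × ℤ) (c : Ω → ℝ)
    (hc : P.μ[Set.indicator {ω | P.Δ (n + 1) ω - P.Δ n ω = d} (fun _ => (1 : ℝ)) | P.F n]
      =ᵐ[P.μ] c) (g : Ω → ℝ) (hg : Measurable[P.F n] g) (hb : ∃ C : ℝ, ∀ ω, |g ω| ≤ C) :
    ∫ ω, g ω * Set.indicator {ω | P.Δ (n + 1) ω - P.Δ n ω = d} (fun _ => (1 : ℝ)) ω ∂P.μ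
      = ∫ ω, g ω * c ω ∂P.μ := by
  have := P.isProb
  have hms : MeasurableSet {ω | P.Δ (n + 1) ω - P.Δ n ω = d} :=
    ((P.D_meas n hn).mono (P.F_le _) le_rfl) (measurableSet_singleton d)
  obtain ⟨C, hC⟩ := id hb
  have h1 := condExp_stronglyMeasurable_mul_of_bound (μ := P.μ) (P.F_le n) hg.stronglyMeasurable
    (g := Set.indicator {ω | P.Δ (n + 1) ω - P.Δ n ω = d} (fun _ => (1 : ℝ)))
    (integrable_bdd (measurable_const.indicator hms) (bdd_ind _)) C
    (Filter.Eventually.of_forall (fun ω => by simpa using hC ω))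
  have h2 := integral_condExp (μ := P.μ) (P.F_le n)
    (f := g * Set.indicator {ω | P.Δ (n + 1) ω - P.Δ n ω = d} (fun _ => (1 : ℝ)))
  rw [show (∫ ω, g ω * Set.indicator {ω | P.Δ (n + 1) ω - P.Δ n ω = d} (fun _ => (1 : ℝ)) ω ∂P.μ)
    = ∫ ω, (g * Set.indicator {ω | P.Δ (n + 1) ω - P.Δ n ω = d} (fun _ => (1 : ℝ))) ω ∂P.μ
    from rfl, ← h2]
  apply integral_congr_ae
  filter_upwards [h1, hc] with ω h1 h2
  rw [h1, Pi.mul_apply, h2]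

lemma step {n : ℕ} (hn : 1 ≤ n) (f : ℤ × ℤ → ℝ)
    (g : Ω → ℝ) (hg : Measurable[P.F n] g) (hb : ∃ C : ℝ, ∀ ω, |g ω| ≤ C) :
    ∫ ω, g ω * f (P.Δ (n + 1) ω - P.Δ n ω) ∂P.μ
      = ∫ ω, g ω * (
        f (1, 1) * (pvs α n (P.Δ n ω).1 (P.Δ n ω).2 * (1 - q))
        + f (-1, 1) * (pvs α n (P.Δ n ω).1 (P.Δ n ω).2 * q)
        + f (1, -1) * ((1 - pvs α n (P.Δ n ω).1 (P.Δ n ω).2) * q)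
        + f (-1, -1) * ((1 - pvs α n (P.Δ n ω).1 (P.Δ n ω).2) * (1 - q))) ∂P.μ := by
  have := P.isProb
  have hg' : Measurable g := hg.mono (P.F_le n) le_rfl
  have hms : ∀ d, MeasurableSet {ω | P.Δ (n + 1) ω - P.Δ n ω = d} := fun d =>
    ((P.D_meas n hn).mono (P.F_le _) le_rfl) (measurableSet_singleton d)
  set I : ℤ × ℤ → Ω → ℝ := fun d =>
    Set.indicator {ω | P.Δ (n + 1) ω - P.Δ n ω = d} (fun _ => (1 : ℝ)) with hI
  have e : ∀ ω, g ω * f (P.Δ (n + 1) ω - P.Δ n ω)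
      = f (1, 1) * (g ω * I (1, 1) ω) + f (-1, 1) * (g ω * I (-1, 1) ω)
        + f (1, -1) * (g ω * I (1, -1) ω) + f (-1, -1) * (g ω * I (-1, -1) ω) := by
    intro ω
    have h := P.D_range n hn ω
    simp only [Set.mem_insert_iff, Set.mem_singleton_iff] at h
    rcases h with h | h | h | h <;> simp [hI, h, mul_comm]
  have iI : ∀ d, Integrable (fun ω => f d * (g ω * I d ω)) P.μ := fun d =>
    (integrable_bdd (hg'.mul (measurable_const.indicator (hms d)))
      (bdd_mul hb (bdd_ind _))).const_mul _
  have ic : ∀ (c : ℝ) (h : ℤ × ℤ → ℝ), Integrable (fun ω => c * (g ω * h (P.Δ n ω))) P.μ :=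
    fun c h => (integrable_bdd (hg'.mul ((meas_comp P hn h).mono (P.F_le n) le_rfl))
      (bdd_mul hb (comp_bdd P hn h))).const_mul _
  have j1 := ic (f (1, 1)) (fun x => pvs α n x.1 x.2 * (1 - q))
  have j2 := ic (f (-1, 1)) (fun x => pvs α n x.1 x.2 * q)
  have j3 := ic (f (1, -1)) (fun x => (1 - pvs α n x.1 x.2) * q)
  have j4 := ic (f (-1, -1)) (fun x => (1 - pvs α n x.1 x.2) * (1 - q))
  have e2 : ∀ ω, g ω * (
        f (1, 1) * (pvs α n (P.Δ n ω).1 (P.Δ n ω).2 * (1 - q))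
        + f (-1, 1) * (pvs α n (P.Δ n ω).1 (P.Δ n ω).2 * q)
        + f (1, -1) * ((1 - pvs α n (P.Δ n ω).1 (P.Δ n ω).2) * q)
        + f (-1, -1) * ((1 - pvs α n (P.Δ n ω).1 (P.Δ n ω).2) * (1 - q)))
      = f (1, 1) * (g ω * (pvs α n (P.Δ n ω).1 (P.Δ n ω).2 * (1 - q)))
        + f (-1, 1) * (g ω * (pvs α n (P.Δ n ω).1 (P.Δ n ω).2 * q))
        + f (1, -1) * (g ω * ((1 - pvs α n (P.Δ n ω).1 (P.Δ n ω).2) * q))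
        + f (-1, -1) * (g ω * ((1 - pvs α n (P.Δ n ω).1 (P.Δ n ω).2) * (1 - q))) := by
    intro ω; ring
  have s1 := single P hn _ _ (P.cond_rr n hn) g hg hb
  have s2 := single P hn _ _ (P.cond_br n hn) g hg hb
  have s3 := single P hn _ _ (P.cond_rb n hn) g hg hb
  have s4 := single P hn _ _ (P.cond_bb n hn) g hg hb
  have addI : ∀ {u v : Ω → ℝ}, Integrable u P.μ → Integrable v P.μ →
    Integrable (fun ω => u ω + v ω) P.μ := fun hu hv => hu.add hv
  simp_rw [e, e2]
  rw [integral_add (addI (addI (iI _) (iI _)) (iI _)) (iI _),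
    integral_add (addI (iI _) (iI _)) (iI _), integral_add (iI _) (iI _),
    integral_add (addI (addI j1 j2) j3) j4, integral_add (addI j1 j2) j3, integral_add j1 j2]
  simp only [integral_const_mul]
  rw [s1, s2, s3, s4]

lemma step_S {n : ℕ} (hn : 1 ≤ n)
    (g : Ω → ℝ) (hg : Measurable[P.F n] g) (hb : ∃ C : ℝ, ∀ ω, |g ω| ≤ C) :
    ∫ ω, g ω * (S P (n + 1) ω - S P n ω - (1 + α - 2 * q) / zz α n * S P n ω) ∂P.μ = 0 := by
  have := P.isProb
  have hg' : Measurable g := hg.mono (P.F_le n) le_rfl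
  have h := step P hn (fun x => (x.1 : ℝ) + α * x.2) g hg hb
  have e1 : ∀ ω, g ω * (S P (n + 1) ω - S P n ω - (1 + α - 2 * q) / zz α n * S P n ω)
      = g ω * (S P (n + 1) ω - S P n ω) - g ω * ((1 + α - 2 * q) / zz α n * S P n ω) := by
    intro ω; ring
  have hS : ∀ n, 1 ≤ n → Measurable (S P n) := fun n hn => (S_meas P hn).mono (P.F_le n) le_rfl
  simp_rw [e1]
  rw [integral_sub, sub_eq_zero]
  · convert h using 3 with ω ω
    · simp [S]; left; ring
    · congr 1
      simp only [pvs, S, Zvs_mul hn]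
      push_cast
      ring
  · exact integrable_bdd (hg'.mul ((hS _ (by omega)).sub (hS n hn)))
      (bdd_mul hb (bdd_sub (S_bdd P (by omega)) (S_bdd P hn)))
  · exact integrable_bdd (hg'.mul (measurable_const.mul (hS n hn)))
      (bdd_mul hb (bdd_mul (bdd_const _) (S_bdd P hn)))

lemma step_M {n : ℕ} (hn : 1 ≤ n)
    (g : Ω → ℝ) (hg : Measurable[P.F n] g) (hb : ∃ C : ℝ, ∀ ω, |g ω| ≤ C) :
    ∫ ω, g ω * (M P (n + 1) ω - M P n ω) ∂P.μ = 0 := by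
  have h := step P hn (fun x => (x.1 : ℝ) - (1 - 2 * q) * x.2) g hg hb
  have e : ∫ ω, g ω * (M P (n + 1) ω - M P n ω) ∂P.μ = ∫ ω : Ω, (0 : ℝ) ∂P.μ := by
    convert h using 3 with ω ω
    · simp [M]; left; ring
    · simp only
      push_cast
      ring
  rw [e]; simp

lemma S_inc {n : ℕ} (hn : 1 ≤ n) (ω : Ω) : |S P (n + 1) ω - S P n ω| ≤ 1 + |α| := by
  have h := P.D_range n hn ω
  have e : S P (n + 1) ω - S P n ω = (((P.Δ (n + 1) ω - P.Δ n ω).1 : ℤ) : ℝ)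
      + α * (((P.Δ (n + 1) ω - P.Δ n ω).2 : ℤ) : ℝ) := by
    simp [S]; ring
  rw [e]
  have a1 := le_abs_self α
  have a2 := neg_abs_le α
  simp only [Set.mem_insert_iff, Set.mem_singleton_iff] at h
  rcases h with h | h | h | h <;> rw [h, abs_le] <;> constructor <;> push_cast <;> linarith

lemma M_inc (hq0 : 0 ≤ q) (hq : q ≤ 1) {n : ℕ} (hn : 1 ≤ n) (ω : Ω) :
    |M P (n + 1) ω - M P n ω| ≤ 2 := by
  have h := P.D_range n hn ω
  have e : M P (n + 1) ω - M P n ω = (((P.Δ (n + 1) ω - P.Δ n ω).1 : ℤ) : ℝ)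
      - (1 - 2 * q) * (((P.Δ (n + 1) ω - P.Δ n ω).2 : ℤ) : ℝ) := by
    simp [M]; ring
  rw [e]
  simp only [Set.mem_insert_iff, Set.mem_singleton_iff] at h
  rcases h with h | h | h | h <;> rw [h, abs_le] <;> constructor <;> push_cast <;> linarith

lemma step_S2 {n : ℕ} (hn : 1 ≤ n)
    (g : Ω → ℝ) (hg : Measurable[P.F n] g) (hb : ∃ C : ℝ, ∀ ω, |g ω| ≤ C) (hg0 : ∀ ω, 0 ≤ g ω) :
    ∫ ω, g ω * (S P (n + 1) ω - S P n ω - (1 + α - 2 * q) / zz α n * S P n ω) ^ 2 ∂P.μ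
      ≤ (1 + |α|) ^ 2 * ∫ ω, g ω ∂P.μ := by
  have := P.isProb
  have hg' : Measurable g := hg.mono (P.F_le n) le_rfl
  have hS : ∀ n, 1 ≤ n → Measurable (S P n) := fun n hn => (S_meas P hn).mono (P.F_le n) le_rfl
  set b := (1 + α - 2 * q) / zz α n with hbdef
  have h := step_S P hn (fun ω => g ω * (b * S P n ω))
    (hg.mul (measurable_const.mul (S_meas P hn)))
    (bdd_mul hb (bdd_mul (bdd_const _) (S_bdd P hn)))
  rw [← hbdef] at h
  have mX : Measurable (fun ω => S P (n + 1) ω - S P n ω - b * S P n ω) :=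
    ((hS _ (by omega)).sub (hS n hn)).sub (measurable_const.mul (hS n hn))
  have bX : ∃ C : ℝ, ∀ ω, |S P (n + 1) ω - S P n ω - b * S P n ω| ≤ C :=
    bdd_sub (bdd_sub (S_bdd P (by omega)) (S_bdd P hn)) (bdd_mul (bdd_const _) (S_bdd P hn))
  have i1 : Integrable (fun ω => (1 + |α|) ^ 2 * g ω) P.μ := (integrable_bdd hg' hb).const_mul _
  have i2 : Integrable (fun ω => 2 * (g ω * (b * S P n ω)
      * (S P (n + 1) ω - S P n ω - b * S P n ω))) P.μ :=
    (integrable_bdd ((hg'.mul (measurable_const.mul (hS n hn))).mul mX)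
      (bdd_mul (bdd_mul hb (bdd_mul (bdd_const _) (S_bdd P hn))) bX)).const_mul _
  calc ∫ ω, g ω * (S P (n + 1) ω - S P n ω - b * S P n ω) ^ 2 ∂P.μ
      ≤ ∫ ω, ((1 + |α|) ^ 2 * g ω - 2 * (g ω * (b * S P n ω)
          * (S P (n + 1) ω - S P n ω - b * S P n ω))) ∂P.μ := by
        apply integral_mono _ (i1.sub i2)
        · intro ω
          have h1 : (S P (n + 1) ω - S P n ω) ^ 2 ≤ (1 + |α|) ^ 2 := by
            rw [← sq_abs (S P (n + 1) ω - S P n ω)]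
            exact pow_le_pow_left₀ (abs_nonneg _) (S_inc P hn ω) 2
          have h2 := mul_le_mul_of_nonneg_left h1 (hg0 ω)
          have h3 := mul_nonneg (hg0 ω) (sq_nonneg (b * S P n ω))
          show g ω * (S P (n + 1) ω - S P n ω - b * S P n ω) ^ 2 ≤
            (1 + |α|) ^ 2 * g ω - 2 * (g ω * (b * S P n ω)
              * (S P (n + 1) ω - S P n ω - b * S P n ω))
          linarith [show g ω * (S P (n + 1) ω - S P n ω - b * S P n ω) ^ 2 =
            g ω * (S P (n + 1) ω - S P n ω) ^ 2 - g ω * (b * S P n ω) ^ 2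
            - 2 * (g ω * (b * S P n ω) * (S P (n + 1) ω - S P n ω - b * S P n ω)) by ring]
        · have := integrable_bdd (μ := P.μ) (hg'.mul (mX.mul mX)) (bdd_mul hb (bdd_mul bX bX))
          simp only [sq]
          exact this
    _ = (1 + |α|) ^ 2 * ∫ ω, g ω ∂P.μ := by
        rw [integral_sub i1 i2, integral_const_mul, integral_const_mul, h]
        ring

end proc

section proc2

variable {α q : ℝ} {Ω : Type} [mΩ : MeasurableSpace Ω] (P : VSIProcess α q Ω)

/-- The shifted filtration. -/
def filt (k : ℕ) : Filtration ℕ mΩ where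
  seq i := P.F (k + i)
  mono' := fun _ _ h => P.F_mono (by omega)
  le' := fun _ => P.F_le _

lemma dev_bound (hα : -1 / 2 ≤ α) (hq : q ≤ 1 / 16) {k : ℕ} (hk : 1 ≤ k)
    (G : Set Ω) (hG : MeasurableSet[P.F k] G) (N : ℕ) (hN : k ≤ N) (l : ℝ) (hl : 0 < l) :
    l ^ 2 * P.μ.real {ω | ω ∈ G ∧ ∃ n, k ≤ n ∧ n ≤ N ∧
        l ≤ |S P n ω / aa α q n - S P k ω / aa α q k|}
      ≤ (1 + |α|) ^ 2 * (4 * (zz α k / aa α q k ^ 2)) * P.μ.real G := by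
  have := P.isProb
  have hGm : MeasurableSet G := P.F_le k _ hG
  set Y : ℕ → Ω → ℝ := fun i ω => G.indicator (fun _ => (1 : ℝ)) ω *
    (S P (k + i) ω / aa α q (k + i) - S P k ω / aa α q k) with hYdef
  have hGi : ∀ i, MeasurableSet[P.F (k + i)] G := fun i => P.F_mono (Nat.le_add_right k i) _ hG
  have hSk : ∀ i, Measurable[P.F (k + i)] (S P k) := fun i =>
    (S_meas P hk).mono (P.F_mono (Nat.le_add_right k i)) le_rfl
  have hGf : ∀ i, Measurable[P.F (k + i)] (G.indicator (fun _ => (1 : ℝ))) := fun i =>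
    measurable_const.indicator (hGi i)
  have hY : ∀ i, Measurable[filt P k i] (Y i) := by
    intro i
    exact (hGf i).mul (((S_meas P (by omega)).div_const _).sub ((hSk i).div_const _))
  have hdivb : ∀ n, 1 ≤ n → ∃ C : ℝ, ∀ ω, |S P n ω / aa α q n| ≤ C := by
    intro n hn
    simp_rw [div_eq_mul_inv]
    exact bdd_mul (S_bdd P hn) (bdd_const _)
  have hb : ∀ i, ∃ C : ℝ, ∀ ω, |Y i ω| ≤ C := fun i =>
    bdd_mul (bdd_ind G) (bdd_sub (hdivb _ (by omega)) (hdivb _ hk))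
  have hdY : ∀ i ω, Y (i + 1) ω - Y i ω = G.indicator (fun _ => (1 : ℝ)) ω * (1 / aa α q (k + i + 1))
      * (S P (k + i + 1) ω - S P (k + i) ω
        - (1 + α - 2 * q) / zz α (k + i) * S P (k + i) ω) := by
    intro i ω
    have h1 := aa_succ (α := α) (q := q) (n := k + i) (by omega)
    have h2 := aa_pos hα hq (k + i)
    have h3 := fac_pos hα hq (n := k + i) (by omega)
    have h4 : S P (k + i) ω / aa α q (k + i) = (1 / aa α q (k + i + 1)) *
        (S P (k + i) ω + (1 + α - 2 * q) / zz α (k + i) * S P (k + i) ω) := by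
      rw [h1]
      field_simp
    simp only [hYdef, ← add_assoc]
    rw [h4]
    ring
  have hm : ∀ i (g : Ω → ℝ), Measurable[filt P k i] g → (∃ C : ℝ, ∀ ω, |g ω| ≤ C) →
      ∫ ω, g ω * (Y (i + 1) ω - Y i ω) ∂P.μ = 0 := by
    intro i g hg hgb
    have := step_S P (n := k + i) (by omega)
      (fun ω => g ω * (G.indicator (fun _ => (1 : ℝ)) ω * (1 / aa α q (k + i + 1))))
      (Measurable.mul hg ((hGf i).mul_const _)) (bdd_mul hgb (bdd_mul (bdd_ind G) (bdd_const _)))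
    simp_rw [hdY]
    rw [← this]
    congr 1
    ext ω
    ring
  have hintG : ∫ ω, G.indicator (fun _ => (1 : ℝ)) ω ∂P.μ = P.μ.real G := by
    rw [integral_indicator hGm]; simp
  have hv : ∀ i, ∫ ω, (Y (i + 1) ω - Y i ω) * (Y (i + 1) ω - Y i ω) ∂P.μ
      ≤ (1 + |α|) ^ 2 * P.μ.real G * (1 / aa α q (k + i + 1) ^ 2) := by
    intro i
    have h := step_S2 P (n := k + i) (by omega) (G.indicator (fun _ => (1 : ℝ))) (hGf i)
      (bdd_ind G) (fun ω => Set.indicator_nonneg (fun _ _ => zero_le_one) _)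
    rw [hintG] at h
    have e : ∀ ω, (Y (i + 1) ω - Y i ω) * (Y (i + 1) ω - Y i ω)
        = (1 / aa α q (k + i + 1) ^ 2) * (G.indicator (fun _ => (1 : ℝ)) ω *
          (S P (k + i + 1) ω - S P (k + i) ω
            - (1 + α - 2 * q) / zz α (k + i) * S P (k + i) ω) ^ 2) := by
      intro ω
      rw [hdY]
      by_cases hω : ω ∈ G
      · simp only [Set.indicator_of_mem hω]
        ring
      · simp only [Set.indicator_of_notMem hω]
        ring
    simp_rw [e]
    rw [integral_const_mul, mul_comm]
    exact mul_le_mul_of_nonneg_right h (by positivity)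
  have hsum := L2_sum (G := filt P k) hY hb hm
    (fun i => (1 + |α|) ^ 2 * P.μ.real G *
      (4 * (zz α k / aa α q k ^ 2) - 4 * (zz α (k + i) / aa α q (k + i) ^ 2)))
    (by simp [hYdef]) (by
      intro i
      refine (hv i).trans ?_
      have h1 := r_step hα hq (n := k + i) (by omega)
      have h2 : 0 ≤ (1 + |α|) ^ 2 * P.μ.real G := by positivity
      have h3 := mul_le_mul_of_nonneg_left h1 h2
      simp only [← add_assoc]
      linarith) (N - k)
  have hmax := L2_max (G := filt P k) hY hb hm (N - k) l hl
  have hset : {ω | ω ∈ G ∧ ∃ n, k ≤ n ∧ n ≤ N ∧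
        l ≤ |S P n ω / aa α q n - S P k ω / aa α q k|} ⊆ {ω | ∃ i ≤ N - k, l ≤ |Y i ω|} := by
    rintro ω ⟨hω, n, h1, h2, h3⟩
    refine ⟨n - k, by omega, ?_⟩
    simp only [hYdef, Set.indicator_of_mem hω, one_mul]
    rw [show k + (n - k) = n by omega]
    exact h3
  have hmono := measureReal_mono (μ := P.μ) hset
  have h4 : 0 ≤ zz α (k + (N - k)) / aa α q (k + (N - k)) ^ 2 :=
    div_nonneg (zz_pos hα (by omega)).le (by positivity)
  have h5 : 0 ≤ (1 + |α|) ^ 2 * P.μ.real G := by positivity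
  have h6 := mul_nonneg h5 h4
  have h7 := mul_le_mul_of_nonneg_left hmono (sq_nonneg l)
  linarith

lemma M_L2 (hq0 : 0 ≤ q) (hq : q ≤ 1) {N : ℕ} (hN : 1 ≤ N) :
    ∫ ω, M P N ω * M P N ω ∂P.μ ≤ 4 * N := by
  have := P.isProb
  have h := L2_sum (μ := P.μ) (G := filt P 1) (Y := fun i => M P (1 + i))
    (fun i => M_meas P (by omega)) (fun i => M_bdd P (by omega))
    (fun i g hg hb => step_M P (n := 1 + i) (by omega) g hg hb)
    (fun i => 4 * ((1 + i : ℕ) : ℝ)) (by simp [M, P.init]) (by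
      intro i
      calc ∫ ω, (M P (1 + (i + 1)) ω - M P (1 + i) ω) * (M P (1 + (i + 1)) ω - M P (1 + i) ω) ∂P.μ
          ≤ ∫ _ω, (4 : ℝ) ∂P.μ := by
            have hMi : ∀ n, 1 ≤ n → Measurable (M P n) :=
              fun n hn => (M_meas P hn).mono (P.F_le n) le_rfl
            have hd := (hMi (1 + (i + 1)) (by omega)).sub (hMi (1 + i) (by omega))
            have hdb := bdd_sub (M_bdd P (n := 1 + (i + 1)) (by omega))
              (M_bdd P (n := 1 + i) (by omega))
            apply integral_mono (integrable_bdd (hd.mul hd) (bdd_mul hdb hdb))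
              (integrable_const _)
            intro ω
            have h1 := M_inc P hq0 hq (n := 1 + i) (by omega) ω
            show (M P (1 + i + 1) ω - M P (1 + i) ω) * (M P (1 + i + 1) ω - M P (1 + i) ω) ≤ 4
            rw [abs_le] at h1
            nlinarith [h1.1, h1.2]
        _ ≤ _ := by
          simp only [integral_const, probReal_univ, one_smul]
          push_cast
          linarith) (N - 1)
  simpa only [show 1 + (N - 1) = N by omega] using h

lemma M_markov (hq0 : 0 ≤ q) (hq : q ≤ 1) {N : ℕ} (hN : 1 ≤ N) (t : ℝ) :
    t * P.μ.real {ω | t ≤ M P N ω * M P N ω} ≤ 4 * N := by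
  have := P.isProb
  have hM : Measurable (M P N) := (M_meas P hN).mono (P.F_le N) le_rfl
  refine le_trans ?_ (M_L2 P hq0 hq hN)
  exact mul_meas_ge_le_integral_of_nonneg (Filter.Eventually.of_forall fun ω => mul_self_nonneg _)
    (integrable_bdd (hM.mul hM) (bdd_mul (M_bdd P hN) (M_bdd P hN))) t

end proc2

section events

variable {α q : ℝ} {Ω : Type} [mΩ : MeasurableSpace Ω] (P : VSIProcess α q Ω)

/-- First time above the high barrier is `k`. -/
def H (A : ℝ) (k : ℕ) : Set Ω :=
  {ω | A * Zvs α k * Real.sqrt k < S P k ω ∧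
    ∀ j, 1 ≤ j → j < k → ¬ (A * Zvs α j * Real.sqrt j < S P j ω)}

/-- The conditioning event. -/
def Ev (A B : ℝ) (N : ℕ) : Set Ω :=
  {ω | ∃ k, 1 ≤ k ∧ k ≤ N ∧ ω ∈ H P A k ∧
    ∀ n, k < n → n ≤ N → B * Zvs α n * Real.sqrt n < S P n ω}

lemma H_meas (A : ℝ) {k : ℕ} (hk : 1 ≤ k) : MeasurableSet[P.F k] (H P A k) := by
  have e : H P A k = {ω | A * Zvs α k * Real.sqrt k < S P k ω} ∩
      ⋂ j, ⋂ (_ : 1 ≤ j), ⋂ (_ : j < k), {ω | A * Zvs α j * Real.sqrt j < S P j ω}ᶜ := by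
    ext ω
    simp [H]
  rw [e]
  refine MeasurableSet.inter ?_ ?_
  · exact (S_meas P hk) measurableSet_Ioi
  · refine MeasurableSet.iInter fun j => MeasurableSet.iInter fun hj =>
      MeasurableSet.iInter fun hjk => MeasurableSet.compl ?_
    exact ((S_meas P hj).mono (P.F_mono hjk.le) le_rfl) measurableSet_Ioi

lemma H_exists {A : ℝ} {n : ℕ} (hn : 1 ≤ n) {ω : Ω}
    (h : A * Zvs α n * Real.sqrt n < S P n ω) : ∃ k, 1 ≤ k ∧ k ≤ n ∧ ω ∈ H P A k := by
  classical
  have hex : ∃ k, 1 ≤ k ∧ A * Zvs α k * Real.sqrt k < S P k ω := ⟨n, hn, h⟩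
  refine ⟨Nat.find hex, (Nat.find_spec hex).1, Nat.find_min' hex ⟨hn, h⟩,
    (Nat.find_spec hex).2, fun j hj hjk hh => Nat.find_min hex hjk ⟨hj, hh⟩⟩

lemma H_unique {A : ℝ} {i j : ℕ} (hi : 1 ≤ i) (hj : 1 ≤ j) {ω : Ω} (h1 : ω ∈ H P A i)
    (h2 : ω ∈ H P A j) : i = j := by
  rcases lt_trichotomy i j with h | h | h
  · exact absurd h1.1 (h2.2 i hi h)
  · exact h
  · exact absurd h2.1 (h1.2 j hj h)

lemma tauHigh_eq {A : ℝ} {k : ℕ} (hk : 1 ≤ k) {ω : Ω} (h : ω ∈ H P A k) :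
    tauHigh P A ω = k := by
  unfold tauHigh
  apply le_antisymm
  · exact sInf_le ⟨k, rfl, hk, h.1⟩
  · apply le_sInf
    rintro _ ⟨n, rfl, hn, hh⟩
    by_contra hlt
    push Not at hlt
    exact h.2 n hn (by exact_mod_cast hlt) hh

lemma tauHigh_le {A : ℝ} {N : ℕ} {ω : Ω} :
    tauHigh P A ω ≤ (N : ℕ∞) ↔ ∃ k, 1 ≤ k ∧ k ≤ N ∧ ω ∈ H P A k := by
  constructor
  · intro h
    have hne : tauHigh P A ω < ((N + 1 : ℕ) : ℕ∞) :=
      lt_of_le_of_lt h (by exact_mod_cast Nat.lt_succ_self N)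
    unfold tauHigh at hne
    rw [sInf_lt_iff] at hne
    obtain ⟨_, ⟨n, rfl, hn, hh⟩, hlt⟩ := hne
    have hnN : n < N + 1 := by exact_mod_cast hlt
    obtain ⟨k, h1, h2, h3⟩ := H_exists P hn hh
    exact ⟨k, h1, by omega, h3⟩
  · rintro ⟨k, h1, h2, h3⟩
    rw [tauHigh_eq P h1 h3]
    exact_mod_cast h2

lemma lt_tauLow {A B : ℝ} {k N : ℕ} (hk : 1 ≤ k) {ω : Ω} (h : ω ∈ H P A k) :
    (N : ℕ∞) < tauLow P A B ω ↔ ∀ n, k < n → n ≤ N → B * Zvs α n * Real.sqrt n < S P n ω := by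
  unfold tauLow
  rw [tauHigh_eq P hk h]
  constructor
  · intro hlt n hn hnN
    by_contra hh
    push Not at hh
    have h1 : sInf {N : ℕ∞ | ∃ n : ℕ, N = (n : ℕ∞) ∧ (k : ℕ∞) < (n : ℕ∞) ∧
      ((P.Δ n ω).1 : ℝ) + α * ((P.Δ n ω).2 : ℝ) ≤ B * Zvs α n * Real.sqrt n} ≤ (n : ℕ∞) :=
      sInf_le ⟨n, rfl, by exact_mod_cast hn, hh⟩
    have h2 : (N : ℕ∞) < n := lt_of_lt_of_le hlt h1
    have h3 : N < n := by exact_mod_cast h2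
    omega
  · intro hall
    have h1 : ((N + 1 : ℕ) : ℕ∞) ≤ sInf {N : ℕ∞ | ∃ n : ℕ, N = (n : ℕ∞) ∧ (k : ℕ∞) < (n : ℕ∞) ∧
      ((P.Δ n ω).1 : ℝ) + α * ((P.Δ n ω).2 : ℝ) ≤ B * Zvs α n * Real.sqrt n} := by
      apply le_sInf
      rintro _ ⟨n, rfl, hn, hh⟩
      by_contra hlt
      push Not at hlt
      have h4 : n < N + 1 := by exact_mod_cast hlt
      have h5 : k < n := by exact_mod_cast hn
      exact absurd (hall n h5 (by omega)) (not_lt.2 hh)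
    exact lt_of_lt_of_le (by exact_mod_cast Nat.lt_succ_self N) h1

lemma event_eq (A B : ℝ) (N : ℕ) :
    {ω | tauHigh P A ω ≤ (N : ℕ∞) ∧ (N : ℕ∞) < tauLow P A B ω} = Ev P A B N := by
  ext ω
  constructor
  · rintro ⟨h1, h2⟩
    obtain ⟨k, a, b, c⟩ := (tauHigh_le P).1 h1
    exact ⟨k, a, b, c, (lt_tauLow P a c).1 h2⟩
  · rintro ⟨k, a, b, c, d⟩
    exact ⟨(tauHigh_le P).2 ⟨k, a, b, c⟩, (lt_tauLow P a c).2 d⟩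

lemma S_meas' {n : ℕ} (hn : 1 ≤ n) : Measurable (S P n) := (S_meas P hn).mono (P.F_le n) le_rfl

lemma Ev_meas (A B : ℝ) (N : ℕ) : MeasurableSet (Ev P A B N) := by
  have e : Ev P A B N = ⋃ k, ⋃ (_ : 1 ≤ k), ⋃ (_ : k ≤ N), (H P A k ∩
      ⋂ n, ⋂ (_ : k < n), ⋂ (_ : n ≤ N), {ω | B * Zvs α n * Real.sqrt n < S P n ω}) := by
    ext ω
    simp only [Ev, Set.mem_ofPred_eq, Set.mem_iUnion, Set.mem_inter_iff, Set.mem_iInter,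
      exists_prop]
  rw [e]
  refine MeasurableSet.iUnion fun k => MeasurableSet.iUnion fun hk => MeasurableSet.iUnion
    fun _ => MeasurableSet.inter (P.F_le k _ (H_meas P A hk)) (MeasurableSet.iInter fun n =>
      MeasurableSet.iInter fun hn => MeasurableSet.iInter fun _ => ?_)
  exact (S_meas' P (by omega)) measurableSet_Ioi

/-- Threshold for the deviation of the martingale. -/
noncomputable def lam (α q A : ℝ) (k : ℕ) : ℝ := A * Zvs α k * Real.sqrt k / (2 * aa α q k)

/-- Bad event. -/
def Bad (A : ℝ) (k N : ℕ) : Set Ω :=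
  {ω | ω ∈ H P A k ∧ ∃ n, k ≤ n ∧ n ≤ N ∧
        lam α q A k ≤ |S P n ω / aa α q n - S P k ω / aa α q k|}

/-- Bad event for the second martingale. -/
def MB (A : ℝ) (k N : ℕ) : Set Ω :=
  {ω | (aa α q N * lam α q A k) ^ 2 / (4 * (1 + |α|) ^ 2) ≤ M P N ω * M P N ω}

lemma lam_pos (hα : -1 / 2 ≤ α) (hq : q ≤ 1 / 16) {A : ℝ} (hA : 0 < A) {k : ℕ} (hk : 1 ≤ k) :
    0 < lam α q A k := by
  have h1 := aa_pos hα hq k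
  have h2 := Zvs_ge hα hk
  have h3 : (0 : ℝ) < k := by exact_mod_cast hk
  have h4 : 0 < Zvs α k := by linarith
  unfold lam
  positivity

lemma lam_sq (hα : -1 / 2 ≤ α) (hq : q ≤ 1 / 16) {A : ℝ} {k : ℕ} (hk : 1 ≤ k) :
    lam α q A k ^ 2 = A ^ 2 * Zvs α k / 4 * (zz α k / aa α q k ^ 2) := by
  have h1 := aa_pos hα hq k
  unfold lam
  rw [← Zvs_mul hk, div_pow, mul_pow, mul_pow, Real.sq_sqrt (by positivity)]
  field_simp
  ring

lemma bad_le (hα : -1 / 2 ≤ α) (hq : q ≤ 1 / 16) {A : ℝ} (hA : 0 < A) {k N : ℕ} (hk : 1 ≤ k)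
    (hN : k ≤ N) :
    P.μ.real (Bad P A k N) ≤ 32 * (1 + |α|) ^ 2 / A ^ 2 * P.μ.real (H P A k) := by
  have := P.isProb
  have h := dev_bound P hα hq hk _ (H_meas P A hk) N hN _ (lam_pos hα hq hA hk)
  change _ * P.μ.real (Bad P A k N) ≤ _ at h
  rw [lam_sq hα hq hk] at h
  have hw : 0 < zz α k / aa α q k ^ 2 :=
    div_pos (zz_pos hα hk) (pow_pos (aa_pos hα hq k) 2)
  set w := zz α k / aa α q k ^ 2
  have hZ := Zvs_ge hα hk
  have hx : 0 ≤ P.μ.real (Bad P A k N) := measureReal_nonneg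
  set x := P.μ.real (Bad P A k N)
  set y := P.μ.real (H P A k)
  have h2 : w * (A ^ 2 * Zvs α k / 4 * x) ≤ w * (4 * (1 + |α|) ^ 2 * y) := by
    linarith
  have h3 := le_of_mul_le_mul_left h2 hw
  have h4 : A ^ 2 * x * (1 / 2) ≤ A ^ 2 * x * Zvs α k :=
    mul_le_mul_of_nonneg_left hZ (by positivity)
  rw [div_mul_eq_mul_div, le_div_iff₀ (by positivity)]
  linarith

lemma good {A : ℝ} {k N : ℕ} {ω : Ω} (hα : -1 / 2 ≤ α) (hq : q ≤ 1 / 16) (h : ω ∈ H P A k)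
    (hb : ω ∉ Bad P A k N) {n : ℕ} (hn : k ≤ n) (hnN : n ≤ N) :
    aa α q n * lam α q A k < S P n ω := by
  have h1 : |S P n ω / aa α q n - S P k ω / aa α q k| < lam α q A k := by
    by_contra hh
    push Not at hh
    exact hb ⟨h, n, hn, hnN, hh⟩
  have ha := aa_pos hα hq n
  have hak := aa_pos hα hq k
  have h2 : 2 * lam α q A k < S P k ω / aa α q k := by
    rw [lt_div_iff₀ hak]
    have := h.1
    have e : 2 * lam α q A k * aa α q k = A * Zvs α k * Real.sqrt k := by
      unfold lam
      field_simp
    rw [e]; exact this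
  rw [abs_lt] at h1
  have h3 : lam α q A k < S P n ω / aa α q n := by linarith
  rw [lt_div_iff₀ ha] at h3
  linarith

lemma low_le (hα : -1 / 2 ≤ α) (hq : q ≤ 1 / 16) {A : ℝ} (hA : 0 < A)
    (hA2 : 32 * (1 + |α|) ≤ A ^ 2) {k n : ℕ} (hk : 1 ≤ k) (hn : k ≤ n) :
    2 * Zvs α n * Real.sqrt n ≤ aa α q n * lam α q A k := by
  have ha := aa_pos hα hq n
  have hl := lam_pos hα hq hA hk
  have hn1 : 1 ≤ n := hk.trans hn
  have hZ := Zvs_ge hα hk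
  have hZn := Zvs_ge hα hn1
  have hZn' := Zvs_le (α := α) hn1
  have hz := zz_pos hα hn1
  have hr := ratio_mono hα hq hk hn
  have hr' : zz α n ≤ aa α q n ^ 2 * (zz α k / aa α q k ^ 2) := by
    rw [div_le_iff₀ (by positivity)] at hr
    linarith
  rw [← pow_le_pow_iff_left₀ (mul_nonneg (by linarith) (Real.sqrt_nonneg _)) (by positivity)
    two_ne_zero, mul_pow, mul_pow (aa α q n), lam_sq hα hq hk, Real.sq_sqrt (by positivity)]
  have e1 : (2 * Zvs α n) ^ 2 * (n : ℝ) = 4 * Zvs α n * zz α n := by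
    rw [← Zvs_mul hn1]; ring
  rw [e1]
  have h1 : 4 * (1 + |α|) ≤ A ^ 2 * Zvs α k / 4 := by nlinarith [sq_nonneg A]
  calc 4 * Zvs α n * zz α n ≤ 4 * (1 + |α|) * zz α n := by
        apply mul_le_mul_of_nonneg_right _ hz.le
        linarith
    _ ≤ A ^ 2 * Zvs α k / 4 * zz α n := mul_le_mul_of_nonneg_right h1 hz.le
    _ ≤ A ^ 2 * Zvs α k / 4 * (aa α q n ^ 2 * (zz α k / aa α q k ^ 2)) :=
        mul_le_mul_of_nonneg_left hr' (by positivity)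
    _ = _ := by ring

lemma sub_Ev (hα : -1 / 2 ≤ α) (hq : q ≤ 1 / 16) {A : ℝ} (hA : 0 < A)
    (hA2 : 32 * (1 + |α|) ≤ A ^ 2) (N : ℕ) :
    (⋃ k ∈ Finset.Icc 1 N, H P A k) ⊆ Ev P A 2 N ∪ ⋃ k ∈ Finset.Icc 1 N, Bad P A k N := by
  intro ω hω
  simp only [Set.mem_iUnion, Finset.mem_Icc, Set.mem_union] at hω ⊢
  obtain ⟨k, ⟨h1, h2⟩, h3⟩ := hω
  by_cases hb : ω ∈ Bad P A k N
  · exact Or.inr ⟨k, ⟨h1, h2⟩, hb⟩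
  · refine Or.inl ⟨k, h1, h2, h3, fun n hn hnN => ?_⟩
    exact lt_of_le_of_lt (low_le hα hq hA hA2 h1 hn.le) (good P hα hq h3 hb hn.le hnN)

lemma pos_of (hα : -1 / 2 ≤ α) (hq0 : 0 < q) (hq : q ≤ 1 / 16) {A : ℝ} (hA : 0 < A) {k N : ℕ}
    (hk : 1 ≤ k) {ω : Ω} (hS : aa α q N * lam α q A k < S P N ω) (hM : ω ∉ MB P A k N) :
    0 < (P.Δ N ω).1 := by
  by_contra hneg
  push Not at hneg
  apply hM
  have hneg' : ((P.Δ N ω).1 : ℝ) ≤ 0 := by exact_mod_cast hneg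
  have hl := mul_pos (aa_pos hα hq N) (lam_pos hα hq hA hk)
  set u := aa α q N * lam α q A k with hu
  have e : (1 + α - 2 * q) * ((P.Δ N ω).1 : ℝ) = (1 - 2 * q) * S P N ω + α * M P N ω := by
    unfold S M; ring
  have h1 : (1 - 2 * q) * S P N ω ≤ - (α * M P N ω) := by
    have : (1 + α - 2 * q) * ((P.Δ N ω).1 : ℝ) ≤ 0 :=
      mul_nonpos_of_nonneg_of_nonpos (by linarith) hneg'
    linarith
  have h2 : - (α * M P N ω) ≤ (1 + |α|) * |M P N ω| := by
    have := neg_abs_le (α * M P N ω)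
    rw [abs_mul] at this
    nlinarith [abs_nonneg (M P N ω)]
  have h3 : u / 2 ≤ (1 + |α|) * |M P N ω| := by nlinarith
  show u ^ 2 / (4 * (1 + |α|) ^ 2) ≤ M P N ω * M P N ω
  rw [div_le_iff₀ (by positivity), ← abs_mul_abs_self (M P N ω)]
  have h4 := pow_le_pow_left₀ (by linarith) h3 2
  nlinarith

lemma Ev_sub (hα : -1 / 2 ≤ α) (hq0 : 0 < q) (hq : q ≤ 1 / 16) {A : ℝ} (hA : 0 < A) (K N : ℕ) :
    Ev P A 2 N \ {ω | 0 < (P.Δ N ω).1} ⊆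
      (⋃ k ∈ Finset.Icc 1 K, Bad P A k N) ∪ (⋃ k ∈ Finset.Icc 1 K, MB P A k N) ∪
        ⋃ k ∈ Finset.Ioc K N, H P A k := by
  rintro ω ⟨⟨k, h1, h2, h3, -⟩, hn⟩
  simp only [Set.mem_iUnion, Finset.mem_Icc, Set.mem_union, Finset.mem_Ioc]
  by_cases hkK : k ≤ K
  · by_cases hb : ω ∈ Bad P A k N
    · exact Or.inl (Or.inl ⟨k, ⟨h1, hkK⟩, hb⟩)
    · by_cases hM : ω ∈ MB P A k N
      · exact Or.inl (Or.inr ⟨k, ⟨h1, hkK⟩, hM⟩)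
      · exact absurd (pos_of P hα hq0 hq hA h1 (good P hα hq h3 hb h2 le_rfl) hM) hn
  · exact Or.inr ⟨k, ⟨by omega, h2⟩, h3⟩

lemma N_div (hα : -1 / 2 ≤ α) (hq : q ≤ 1 / 16) :
    Tendsto (fun N : ℕ => (N : ℝ) / aa α q N ^ 2) atTop (nhds 0) := by
  have h1 : Tendsto (fun N : ℕ => Real.sqrt (8 / (N : ℝ))) atTop (nhds 0) := by
    have := (tendsto_const_div_atTop_nhds_zero_nat (8 : ℝ)).sqrt
    simpa using this
  apply squeeze_zero' (Filter.Eventually.of_forall fun N => by positivity) _ h1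
  filter_upwards [eventually_ge_atTop 1] with N hN
  have ha := aa_pos hα hq N
  have hN' : (0 : ℝ) < N := by exact_mod_cast hN
  apply Real.le_sqrt_of_sq_le
  rw [div_pow, div_le_div_iff₀ (by positivity) hN', ← pow_mul]
  have h2 := fourth hα hq hN
  have h3 := pow_le_pow_left₀ (by positivity) (zz_ge hα hN) 3
  norm_num
  nlinarith

lemma MB_tendsto (hα : -1 / 2 ≤ α) (hq0 : 0 < q) (hq : q ≤ 1 / 16) {A : ℝ} (hA : 0 < A) {k : ℕ}
    (hk : 1 ≤ k) : Tendsto (fun N : ℕ => P.μ.real (MB P A k N)) atTop (nhds 0) := by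
  have h1 := (N_div hα hq).const_mul (16 * (1 + |α|) ^ 2 / lam α q A k ^ 2)
  rw [mul_zero] at h1
  apply squeeze_zero' (Filter.Eventually.of_forall fun N => measureReal_nonneg) _ h1
  filter_upwards [eventually_ge_atTop 1] with N hN
  have h := M_markov P hq0.le (by linarith) hN ((aa α q N * lam α q A k) ^ 2 / (4 * (1 + |α|) ^ 2))
  change _ * P.μ.real (MB P A k N) ≤ _ at h
  have ha := aa_pos hα hq N
  have hl := lam_pos hα hq hA hk
  rw [div_mul_div_comm, le_div_iff₀ (by positivity)]
  rw [div_mul_eq_mul_div, div_le_iff₀ (by positivity)] at h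
  linarith

lemma straight (hq : q < 1) (hα : -1 / 2 ≤ α) {n : ℕ} (hn : 1 ≤ n) :
    0 < P.μ.real {ω | P.Δ n ω = ((n : ℤ), (n : ℤ) - 1)} := by
  have := P.isProb
  induction n, hn using Nat.le_induction with
  | base =>
    have : {ω | P.Δ 1 ω = (((1 : ℕ) : ℤ), ((1 : ℕ) : ℤ) - 1)} = Set.univ := by
      ext ω; simp [P.init]
    rw [this]; simp
  | succ n hn ih =>
    set G := {ω | P.Δ n ω = ((n : ℤ), (n : ℤ) - 1)} with hG
    have hGm : MeasurableSet[P.F n] G := (P.adapted n hn) (measurableSet_singleton _)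
    have hD : MeasurableSet {ω | P.Δ (n + 1) ω - P.Δ n ω = (1, 1)} :=
      ((P.D_meas n hn).mono (P.F_le _) le_rfl) (measurableSet_singleton (1, 1))
    have hs := single P hn _ _ (P.cond_rr n hn) (G.indicator (fun _ => 1))
      (measurable_const.indicator hGm) (bdd_ind G)
    have e1 : ∫ ω, G.indicator (fun _ => (1 : ℝ)) ω *
        Set.indicator {ω | P.Δ (n + 1) ω - P.Δ n ω = (1, 1)} (fun _ => (1 : ℝ)) ω ∂P.μ
        = P.μ.real (G ∩ {ω | P.Δ (n + 1) ω - P.Δ n ω = (1, 1)}) := by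
      rw [← integral_indicator_one ((P.F_le n _ hGm).inter hD)]
      congr 1
      ext ω
      generalize {ω | P.Δ (n + 1) ω - P.Δ n ω = (1, 1)} = T
      by_cases h1 : ω ∈ G <;> by_cases h2 : ω ∈ T <;> simp [h1, h2]
    have e2 : ∫ ω, G.indicator (fun _ => (1 : ℝ)) ω *
        (pvs α n (P.Δ n ω).1 (P.Δ n ω).2 * (1 - q)) ∂P.μ = (1 - q) * P.μ.real G := by
      rw [← integral_indicator_one (P.F_le n _ hGm), ← integral_const_mul]
      congr 1
      ext ω
      by_cases hω : ω ∈ G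
      · have hω' : P.Δ n ω = ((n : ℤ), (n : ℤ) - 1) := hω
        have hp : pvs α n (P.Δ n ω).1 (P.Δ n ω).2 = 1 := by
          have hz := zz_pos hα hn
          rw [hω', pvs, Zvs_mul hn]
          push_cast
          rw [show (n : ℝ) + α * ((n : ℝ) - 1) = zz α n by unfold zz; ring, div_self hz.ne']
          norm_num
        simp [hω, hp]
      · simp [hω]
    rw [e1, e2] at hs
    have hsub : G ∩ {ω | P.Δ (n + 1) ω - P.Δ n ω = (1, 1)} ⊆
        {ω | P.Δ (n + 1) ω = (((n + 1 : ℕ) : ℤ), ((n + 1 : ℕ) : ℤ) - 1)} := by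
      rintro ω ⟨h1, h2⟩
      have h1 : P.Δ n ω = ((n : ℤ), (n : ℤ) - 1) := h1
      have h2 : P.Δ (n + 1) ω - P.Δ n ω = (1, 1) := h2
      have : P.Δ (n + 1) ω = (1, 1) + P.Δ n ω := by rw [← h2]; simp
      show P.Δ (n + 1) ω = _
      rw [this, h1]
      ext <;> simp <;> ring
    have hmono := measureReal_mono (μ := P.μ) hsub
    have : 0 < (1 - q) * P.μ.real G := mul_pos (by linarith) ih
    linarith

end events

section final

variable {α q : ℝ} {Ω : Type} [mΩ : MeasurableSpace Ω] (P : VSIProcess α q Ω)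

/-- Probability that the high barrier is crossed by time `N`. -/
noncomputable def hs (A : ℝ) (N : ℕ) : ℝ := ∑ k ∈ Finset.Icc 1 N, P.μ.real (H P A k)

lemma hs_eq (A : ℝ) (N : ℕ) : P.μ.real (⋃ k ∈ Finset.Icc 1 N, H P A k) = hs P A N := by
  have := P.isProb
  unfold hs
  refine measureReal_biUnion_finset ?_ ?_
  · intro i hi j hj hij
    simp only [Finset.coe_Icc, Set.mem_Icc] at hi hj
    rw [Function.onFun, Set.disjoint_left]
    intro ω h1 h2
    exact hij (H_unique P hi.1 hj.1 h1 h2)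
  · intro k hk
    exact P.F_le k _ (H_meas P A (Finset.mem_Icc.1 hk).1)

lemma hs_mono (A : ℝ) : Monotone (hs P A) := by
  intro m n h
  exact Finset.sum_le_sum_of_subset_of_nonneg (Finset.Icc_subset_Icc le_rfl h)
    (fun _ _ _ => measureReal_nonneg)

lemma hs_split (A : ℝ) {K N : ℕ} (h : K ≤ N) :
    ∑ k ∈ Finset.Ioc K N, P.μ.real (H P A k) = hs P A N - hs P A K := by
  have e : ∀ n, hs P A n = ∑ k ∈ Finset.Ioc 0 n, P.μ.real (H P A k) := fun n => rfl
  rw [e, e, ← Finset.sum_Ioc_consecutive _ (Nat.zero_le K) h]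
  ring

lemma hs_tendsto (A : ℝ) (hα : -1 / 2 ≤ α) (hq : q < 1) :
    ∃ t, 0 < t ∧ Tendsto (hs P A) atTop (nhds t) ∧ ∀ n, hs P A n ≤ t := by
  have := P.isProb
  have hbdd : BddAbove (Set.range (hs P A)) := by
    refine ⟨1, ?_⟩
    rintro _ ⟨n, rfl⟩
    rw [← hs_eq]
    exact measureReal_le_one
  refine ⟨⨆ n, hs P A n, ?_, tendsto_atTop_ciSup (hs_mono P A) hbdd, fun n => le_ciSup hbdd n⟩
  obtain ⟨n, hn⟩ := exists_nat_gt (A ^ 2)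
  have hn0 : (0 : ℝ) < n := lt_of_le_of_lt (sq_nonneg A) hn
  have hn1 : 1 ≤ n := by
    have : 0 < n := by exact_mod_cast hn0
    omega
  refine lt_of_lt_of_le (straight P hq hα hn1) (le_trans ?_ (le_ciSup hbdd n))
  rw [← hs_eq]
  refine measureReal_mono ?_ (measure_ne_top _ _)
  intro ω hω
  have hω : P.Δ n ω = ((n : ℤ), (n : ℤ) - 1) := hω
  have hhigh : A * Zvs α n * Real.sqrt n < S P n ω := by
    have e : S P n ω = zz α n := by
      unfold S zz
      rw [hω]
      push_cast
      ring
    rw [e, ← Zvs_mul hn1]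
    have h1 : A < Real.sqrt n := Real.lt_sqrt_of_sq_lt hn
    have h2 : 0 < Real.sqrt n := Real.sqrt_pos.2 hn0
    have h3 := Zvs_ge hα hn1
    have h5 := Real.mul_self_sqrt hn0.le
    have h4 : 0 < Zvs α n * Real.sqrt n := mul_pos (by linarith) h2
    calc A * Zvs α n * Real.sqrt n = A * (Zvs α n * Real.sqrt n) := by ring
      _ < Real.sqrt n * (Zvs α n * Real.sqrt n) := mul_lt_mul_of_pos_right h1 h4
      _ = Zvs α n * (Real.sqrt n * Real.sqrt n) := by ring
      _ = Zvs α n * n := by rw [h5]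
  obtain ⟨k, h1, h2, h3⟩ := H_exists P hn1 hhigh
  simp only [Set.mem_iUnion, Finset.mem_Icc]
  exact ⟨k, ⟨h1, h2⟩, h3⟩

lemma main_small (hα : -1 / 2 ≤ α) (hq0 : 0 < q) (hq : q ≤ 1 / 16) {A : ℝ} (hA : 0 < A)
    (hA2 : 64 * (1 + |α|) ^ 2 ≤ A ^ 2) :
    ∀ᶠ N : ℕ in atTop, 1 - 8 * (32 * (1 + |α|) ^ 2 / A ^ 2) ≤
      ((ProbabilityTheory.cond P.μ (Ev P A 2 N)) {ω | 0 < (P.Δ N ω).1}).toReal := by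
  have := P.isProb
  have hA2' : 32 * (1 + |α|) ≤ A ^ 2 := by nlinarith [abs_nonneg α]
  obtain ⟨t, ht, hlim, hle⟩ := hs_tendsto P A hα (by linarith)
  set ε := 32 * (1 + |α|) ^ 2 / A ^ 2 with hε
  have hε0 : 0 < ε := by positivity
  have hε1 : ε ≤ 1 / 2 := by
    rw [hε, div_le_iff₀ (by positivity)]; linarith
  obtain ⟨K, hK⟩ : ∃ K, t - ε * t / 2 < hs P A K := by
    have : t - ε * t / 2 < t := by
      have : 0 < ε * t := by positivity
      linarith
    exact (hlim.eventually (lt_mem_nhds this)).exists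
  have hMB : Tendsto (fun N : ℕ => ∑ k ∈ Finset.Icc 1 K, P.μ.real (MB P A k N)) atTop (nhds 0) := by
    have := tendsto_finsetSum (Finset.Icc 1 K) (fun k hk =>
      MB_tendsto P hα hq0 hq hA (Finset.mem_Icc.1 hk).1)
    simpa using this
  have hMB' : ∀ᶠ N : ℕ in atTop, ∑ k ∈ Finset.Icc 1 K, P.μ.real (MB P A k N) < ε * t / 2 :=
    hMB.eventually (gt_mem_nhds (by positivity))
  filter_upwards [hMB', eventually_ge_atTop K, eventually_ge_atTop 1] with N h1 hKN hN1
  have hmono := hs_mono P A hKN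
  have hbadsum : ∀ J ≤ N, P.μ.real (⋃ k ∈ Finset.Icc 1 J, Bad P A k N) ≤ ε * hs P A J := by
    intro J hJ
    refine (measureReal_biUnion_finset_le _ _).trans ?_
    unfold hs
    rw [Finset.mul_sum]
    apply Finset.sum_le_sum
    intro k hk
    rw [Finset.mem_Icc] at hk
    exact bad_le P hα hq hA hk.1 (hk.2.trans hJ)
  have hEv : hs P A N ≤ P.μ.real (Ev P A 2 N) + ε * hs P A N := by
    calc hs P A N = P.μ.real (⋃ k ∈ Finset.Icc 1 N, H P A k) := (hs_eq P A N).symm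
      _ ≤ P.μ.real (Ev P A 2 N ∪ ⋃ k ∈ Finset.Icc 1 N, Bad P A k N) :=
          measureReal_mono (sub_Ev P hα hq hA hA2' N)
      _ ≤ P.μ.real (Ev P A 2 N) + P.μ.real (⋃ k ∈ Finset.Icc 1 N, Bad P A k N) :=
          measureReal_union_le _ _
      _ ≤ _ := by linarith [hbadsum N le_rfl]
  have hbad : P.μ.real (Ev P A 2 N \ {ω | 0 < (P.Δ N ω).1})
      ≤ ε * hs P A K + ε * t / 2 + (hs P A N - hs P A K) := by
    refine (measureReal_mono (Ev_sub P hα hq0 hq hA K N)).trans ?_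
    refine (measureReal_union_le _ _).trans ?_
    refine add_le_add ((measureReal_union_le _ _).trans (add_le_add (hbadsum K hKN) ?_)) ?_
    · exact (measureReal_biUnion_finset_le _ _).trans h1.le
    · rw [← hs_split P A hKN]
      exact measureReal_biUnion_finset_le _ _
  have hmD : MeasurableSet {ω | 0 < (P.Δ N ω).1} := by
    have h := (P.adapted N hN1).mono (P.F_le N) le_rfl
    exact h (MeasurableSet.of_discrete (s := {x : ℤ × ℤ | 0 < x.1}))
  have hsplit := measureReal_inter_add_sdiff (μ := P.μ) (s := Ev P A 2 N) hmD
  rw [ProbabilityTheory.cond_apply (Ev_meas P A 2 N), ENNReal.toReal_mul, ENNReal.toReal_inv]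
  change _ ≤ (P.μ.real (Ev P A 2 N))⁻¹ * P.μ.real (Ev P A 2 N ∩ {ω | 0 < (P.Δ N ω).1})
  set e := P.μ.real (Ev P A 2 N)
  have hNt := hle N
  have hKt := hle K
  have hεt : ε * t ≤ t / 2 := by nlinarith
  have hεh : ε * hs P A N ≤ hs P A N / 2 := by nlinarith
  have he : t / 4 ≤ e := by linarith
  have he0 : 0 < e := by linarith
  have hεK : ε * hs P A K ≤ ε * t := mul_le_mul_of_nonneg_left hKt hε0.le
  rw [inv_mul_eq_div, le_div_iff₀ he0]
  have h5 : ε * (t / 4) ≤ ε * e := mul_le_mul_of_nonneg_left he hε0.le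
  linarith

end final

end VSI

/-- For very simple increasing trees there are `B > 1` and `c_{α,1} > 0` such that for every
`q ∈ (0,1]`, with `A = q^(-1/4)`,
`liminf_N μ(Δ₁(N) > 0 | τ_high(A) ≤ N, τ_low(B) > N) ≥ 1 - c_{α,1} √q`. -/
theorem vsi_conditional_majority_bound (α : ℝ) (hα : α ∈ vsiAllowed) :
    ∃ B c : ℝ, 1 < B ∧ 0 < c ∧
      ∀ q : ℝ, 0 < q → q ≤ 1 →
        ∀ (Ω : Type) [MeasurableSpace Ω] (P : VSIProcess α q Ω),
          1 - c * Real.sqrt q ≤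
            Filter.liminf (fun N : ℕ =>
              ((ProbabilityTheory.cond P.μ
                  {ω | tauHigh P (q ^ (-(1 : ℝ) / 4)) ω ≤ (N : ℕ∞) ∧
                    (N : ℕ∞) < tauLow P (q ^ (-(1 : ℝ) / 4)) B ω})
                {ω | 0 < (P.Δ N ω).1}).toReal)
              Filter.atTop := by
  have hα' : -1 / 2 ≤ α := by
    rcases hα with ⟨d, hd, rfl⟩ | h
    · have hd' : (2 : ℝ) ≤ d := by exact_mod_cast hd
      rw [div_le_div_iff₀ (by norm_num) (by linarith)]
      linarith
    · have : (0 : ℝ) ≤ α := h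
      linarith
  refine ⟨2, 256 * (1 + |α|) ^ 2, by norm_num, by positivity, ?_⟩
  intro q hq0 hq1 Ω _ P
  have := P.isProb
  set f : ℕ → ℝ := fun N : ℕ =>
    ((ProbabilityTheory.cond P.μ
        {ω | tauHigh P (q ^ (-(1 : ℝ) / 4)) ω ≤ (N : ℕ∞) ∧
          (N : ℕ∞) < tauLow P (q ^ (-(1 : ℝ) / 4)) 2 ω})
      {ω | 0 < (P.Δ N ω).1}).toReal with hf
  have hcb : Filter.IsCoboundedUnder (· ≥ ·) atTop f := by
    apply Filter.IsBoundedUnder.isCoboundedUnder_ge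
    refine Filter.isBoundedUnder_of ⟨1, fun N => ?_⟩
    have h1 := prob_le_one (μ := ProbabilityTheory.cond P.μ
      {ω | tauHigh P (q ^ (-(1 : ℝ) / 4)) ω ≤ (N : ℕ∞) ∧
          (N : ℕ∞) < tauLow P (q ^ (-(1 : ℝ) / 4)) 2 ω}) (s := {ω | 0 < (P.Δ N ω).1})
    exact ENNReal.toReal_le_of_le_ofReal zero_le_one (by simpa using h1)
  apply Filter.le_liminf_of_le hcb
  have hs0 : 0 < Real.sqrt q := Real.sqrt_pos.2 hq0
  by_cases hbig : 1 ≤ 256 * (1 + |α|) ^ 2 * Real.sqrt q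
  · refine Filter.Eventually.of_forall fun N => ?_
    have : 0 ≤ f N := ENNReal.toReal_nonneg
    linarith
  · push Not at hbig
    have hA : 0 < q ^ (-(1 : ℝ) / 4) := Real.rpow_pos_of_pos hq0 _
    have hAs : (q ^ (-(1 : ℝ) / 4)) ^ 2 = (Real.sqrt q)⁻¹ := by
      rw [Real.sqrt_eq_rpow, ← Real.rpow_neg hq0.le, ← Real.rpow_natCast, ← Real.rpow_mul hq0.le]
      norm_num
    have hL : 1 ≤ (1 + |α|) ^ 2 := by nlinarith [abs_nonneg α]
    have hsq : Real.sqrt q ≤ 1 / 4 := by nlinarith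
    have hq : q ≤ 1 / 16 := by
      have := Real.mul_self_sqrt hq0.le
      nlinarith
    have hA2 : 64 * (1 + |α|) ^ 2 ≤ (q ^ (-(1 : ℝ) / 4)) ^ 2 := by
      rw [hAs, le_inv_comm₀ (by positivity) hs0, ← one_div, le_div_iff₀ (by positivity)]
      nlinarith
    filter_upwards [VSI.main_small P hα' hq0 hq hA hA2] with N hN
    rw [hAs, div_inv_eq_mul] at hN
    simp only [hf, VSI.event_eq]
    linarith
end

section
/- Let α ∈ {−1/d : d ∈ ℕ, d ≥ 2} ∪ [0,∞) and γ ∈ (0, 1/2). There exist constants B > 1 and q₀ ∈ (0,1), depending only on α and γ, such that for every q ∈ (0, q₀), every very simple increasing color-difference process (Δ(n))_{n≥1} with parameters (α, q), and every N ≥ 1, with A := q^{γ − 1/2}: μ( τ_low(B) ≤ N ) ≤ B²·(α+2)²·q^{1−2γ}. -/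
open MeasureTheory Filter
open scoped ENat


namespace VSIaux

lemma core (a q N W s : ℝ) (ha : 1/2 ≤ a) (hN : 1 ≤ N) (hW1 : 1 ≤ W) (hWN : N ≤ 2 * W)
    (hq : q * (16 * (1 + a)^2) ≤ 1) (hq0 : 0 ≤ q) (hs0 : 0 ≤ s)
    (hs : s * (4 * (1 + a)^2 * W) ≤ 1) :
    (W + a)^2 / (N + 1) * (1 - 2 * (a - 2 * q) / W + s) ≤ W^2 / N := by
  have hW : 0 < W := by linarith
  obtain ⟨r, hr⟩ : ∃ r, r = a / W := ⟨_, rfl⟩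
  have har : a = r * W := by rw [hr]; field_simp
  have hr0 : 0 ≤ r := by rw [hr]; positivity
  have hra : r ≤ a := by rw [hr]; exact div_le_self (by linarith) hW1
  obtain ⟨y, hy⟩ : ∃ y, y = 4 * q / W + s := ⟨_, rfl⟩
  have hy0 : 0 ≤ y := by rw [hy]; positivity
  have hyW : y * (2 * (1 + a)^2 * W) ≤ 1 := by
    have : y * (2 * (1 + a)^2 * W) = q * (16 * (1 + a)^2) / 2 + s * (4 * (1 + a)^2 * W) / 2 := by
      rw [hy]; field_simp; ring
    rw [this]; linarith
  have hyN : (1 + a)^2 * y * N ≤ 1 := by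
    have : (1 + a)^2 * y * N ≤ (1 + a)^2 * y * (2 * W) := by gcongr
    linarith
  have h1 : (1 + r)^2 * y ≤ (1 + a)^2 * y := by gcongr
  have h2 : (1 + r)^2 * (1 - 2 * r + y) ≤ 1 + (1 + a)^2 * y := by
    have : 0 ≤ 3 * r^2 + 2 * r^3 := by positivity
    nlinarith
  have h3 : (W + a)^2 / (N + 1) * (1 - 2 * (a - 2 * q) / W + s)
      = W^2 / (N + 1) * ((1 + r)^2 * (1 - 2 * r + y)) := by
    rw [hy, hr]; field_simp; ring
  rw [h3]
  have h4 : W^2 / N = W^2 / (N + 1) * (1 + 1 / N) := by field_simp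
  rw [h4]
  have h5 : (1 + a)^2 * y ≤ 1 / N := by rw [le_div_iff₀ (by linarith)]; exact hyN
  gcongr
  linarith

lemma inv_sq_bound (t : ℝ) (h1 : -(1/2) ≤ t) : 1 / (1 + t)^2 ≤ 1 - 2 * t + 8 * t^2 := by
  rw [div_le_iff₀ (by nlinarith)]
  have h : 0 ≤ t^2 * ((1 + 2 * t) * (5 + 4 * t)) := by
    apply mul_nonneg (sq_nonneg _)
    apply mul_nonneg <;> linarith
  nlinarith [sq_nonneg (t^2), sq_nonneg t]

lemma Z_ge (α : ℝ) (hα : -(1/2) ≤ α) (n : ℕ) (hn : 1 ≤ n) : 1/2 ≤ Zvs α n := by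
  have hN : (1:ℝ) ≤ n := by exact_mod_cast hn
  unfold Zvs
  have h1 : 1 / (n:ℝ) ≤ 1 := by rw [div_le_one (by linarith)]; exact hN
  have h0 : 0 ≤ 1 / (n:ℝ) := by positivity
  nlinarith

lemma step (α q B x δ : ℝ) (n : ℕ) (hα : -(1/2) ≤ α) (hn : 1 ≤ n) (hq0 : 0 ≤ q)
    (hq : q * (16 * (2 + α)^2) ≤ 1) (hB : B = 8 * (1 + |α|) * (2 + α))
    (hx : B * Zvs α n * Real.sqrt n < x) (hδ : |δ| ≤ 1 + |α|) :
    1 ≤ x ∧ 0 < x + δ ∧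
    (Zvs α (n+1))^2 * ((n:ℝ)+1) / (x + δ)^2 ≤ (Zvs α n)^2 * n / x^2 +
      (-2 * ((Zvs α (n+1))^2 * ((n:ℝ)+1)) / x^3) *
        (δ - (1 + α - 2 * q) * (x / (Zvs α n * n))) := by
  have hN : (1:ℝ) ≤ n := by exact_mod_cast hn
  have hZ := Z_ge α hα n hn
  have hσ : 1 ≤ 1 + |α| := by linarith [abs_nonneg α]
  have hB12 : 12 * (1 + |α|) ≤ B := by rw [hB]; nlinarith
  have hsq : 1 ≤ Real.sqrt n := by rw [Real.one_le_sqrt]; exact hN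
  have hx6 : 6 * (1 + |α|) < x := by
    have : B * (1/2) * 1 ≤ B * Zvs α n * Real.sqrt n := by
      have : 0 ≤ B := by linarith
      gcongr
    linarith
  have hx0 : 0 < x := by linarith
  obtain ⟨hδ1, hδ2⟩ := abs_le.mp hδ
  refine ⟨by linarith, by linarith, ?_⟩
  obtain ⟨W, hW⟩ : ∃ W, W = Zvs α n * n := ⟨_, rfl⟩
  obtain ⟨c, hc⟩ : ∃ c, c = (Zvs α (n+1))^2 * ((n:ℝ)+1) := ⟨_, rfl⟩
  have hWe : W = (1 + α) * n - α := by rw [hW]; unfold Zvs; field_simp; ring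
  have hce : c = (W + (1 + α))^2 / (n + 1) := by
    rw [hc, hWe]; unfold Zvs; push_cast; field_simp; ring
  have hZe : (Zvs α n)^2 * n = W^2 / n := by rw [hW]; field_simp
  have hW1 : 1 ≤ W := by rw [hWe]; nlinarith
  have hWN : (n:ℝ) ≤ 2 * W := by rw [hW]; nlinarith
  have hc0 : 0 ≤ c := by rw [hc]; positivity
  have hx2 : B^2 * (W^2 / n) ≤ x^2 := by
    have h1 : (B * Zvs α n * Real.sqrt n)^2 = B^2 * ((Zvs α n)^2 * n) := by
      rw [mul_pow, Real.sq_sqrt (by linarith)]; ring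
    rw [← hZe, ← h1]
    have : 0 ≤ B * Zvs α n * Real.sqrt n := by
      have : 0 ≤ B := by linarith
      positivity
    gcongr
  have hs : 8 * (1 + |α|)^2 / x^2 * (4 * (1 + (1 + α))^2 * W) ≤ 1 := by
    rw [div_mul_eq_mul_div, div_le_one (by positivity)]
    refine le_trans ?_ hx2
    have : W ≤ 2 * (W^2 / n) := by
      rw [← mul_div_assoc, le_div_iff₀ (by linarith)]
      nlinarith
    rw [hB]
    have h3 : 8 * (1 + |α|)^2 * (4 * (1 + (1 + α))^2 * W)
       ≤ 8 * (1 + |α|)^2 * (4 * (1 + (1 + α))^2 * (2 * (W^2 / n))) := by gcongr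
    refine h3.trans (le_of_eq ?_)
    ring
  have hcore := core (1 + α) q n W (8 * (1 + |α|)^2 / x^2) (by linarith) hN hW1 hWN
    (by rw [show 1 + (1 + α) = 2 + α by ring]; exact hq) hq0 (by positivity) hs
  rw [← hce, ← hZe] at hcore
  rw [← hW, ← hc]
  have ht := inv_sq_bound (δ / x) (by rw [le_div_iff₀ hx0]; linarith)
  have hδsq : δ^2 ≤ (1 + |α|)^2 := by rw [← sq_abs δ]; gcongr
  have hxd : 0 < x + δ := by linarith
  calc c / (x + δ)^2 = c / x^2 * (1 / (1 + δ / x)^2) := by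
        have : 1 + δ / x = (x + δ) / x := by field_simp
        rw [this]; field_simp
    _ ≤ c / x^2 * (1 - 2 * (δ / x) + 8 * (δ / x)^2) := by gcongr
    _ ≤ c / x^2 * (1 - 2 * (δ / x) + 8 * (1 + |α|)^2 / x^2) := by
        rw [div_pow, ← mul_div_assoc 8]; gcongr
    _ = c * (1 - 2 * (1 + α - 2 * q) / W + 8 * (1 + |α|)^2 / x^2) / x^2
        + (-2 * c / x^3) * (δ - (1 + α - 2 * q) * (x / W)) := by
        field_simp; ring
    _ ≤ _ := by gcongr

variable {α q : ℝ} {Ω : Type} [mΩ : MeasurableSpace Ω]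

/-- The process `X = Δ₁ + α Δ₂`. -/
noncomputable def X (P : VSIProcess α q Ω) (n : ℕ) (ω : Ω) : ℝ :=
  ((P.Δ n ω).1 : ℝ) + α * ((P.Δ n ω).2 : ℝ)

lemma X_meas (P : VSIProcess α q Ω) (n : ℕ) (hn : 1 ≤ n) : Measurable[P.F n] (X P n) := by
  have h : Measurable (fun z : ℤ × ℤ => ((z.1 : ℝ) + α * (z.2 : ℝ))) := measurable_of_countable _
  exact h.comp (P.adapted n hn)

lemma delta_bound (P : VSIProcess α q Ω) (n : ℕ) (hn : 1 ≤ n) (ω : Ω) :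
    |X P (n+1) ω - X P n ω| ≤ 1 + |α| := by
  have h := P.D_range n hn ω
  have e : X P (n+1) ω - X P n ω = (((P.Δ (n+1) ω - P.Δ n ω).1 : ℤ) : ℝ)
      + α * (((P.Δ (n+1) ω - P.Δ n ω).2 : ℤ) : ℝ) := by
    simp [X]; ring
  rw [e]
  rcases h with h | h | h | h <;> rw [h] <;> refine (abs_add_le _ _).trans ?_ <;> simp

lemma delta_eq (P : VSIProcess α q Ω) (n : ℕ) (hn : 1 ≤ n) :
    (fun ω => X P (n+1) ω - X P n ω) =
      (1 + α) • Set.indicator {ω | P.Δ (n + 1) ω - P.Δ n ω = (1, 1)} (fun _ => (1 : ℝ))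
      + (-1 + α) • Set.indicator {ω | P.Δ (n + 1) ω - P.Δ n ω = (-1, 1)} (fun _ => (1 : ℝ))
      + (1 - α) • Set.indicator {ω | P.Δ (n + 1) ω - P.Δ n ω = (1, -1)} (fun _ => (1 : ℝ))
      + (-1 - α) • Set.indicator {ω | P.Δ (n + 1) ω - P.Δ n ω = (-1, -1)} (fun _ => (1 : ℝ)) := by
  funext ω
  have h := P.D_range n hn ω
  have e : X P (n+1) ω - X P n ω = (((P.Δ (n+1) ω - P.Δ n ω).1 : ℤ) : ℝ)
      + α * (((P.Δ (n+1) ω - P.Δ n ω).2 : ℤ) : ℝ) := by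
    simp [X]; ring
  rw [e]
  simp only [Pi.add_apply, Pi.smul_apply, Set.indicator_apply, Set.mem_ofPred_eq]
  simp only [Set.mem_insert_iff, Set.mem_singleton_iff] at h
  rcases h with h | h | h | h <;> simp [h] <;> ring

lemma ind_int (P : VSIProcess α q Ω) (n : ℕ) (hn : 1 ≤ n) (z : ℤ × ℤ) :
    Integrable (Set.indicator {ω | P.Δ (n + 1) ω - P.Δ n ω = z} (fun _ => (1 : ℝ))) P.μ := by
  have := P.isProb
  refine (integrable_const (1:ℝ)).indicator ?_
  have h := (P.D_meas n hn) (measurableSet_singleton z)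
  exact P.F_le _ _ h

lemma delta_int (P : VSIProcess α q Ω) (n : ℕ) (hn : 1 ≤ n) :
    Integrable (fun ω => X P (n+1) ω - X P n ω) P.μ := by
  rw [delta_eq P n hn]
  exact ((((ind_int P n hn _).smul _).add ((ind_int P n hn _).smul _)).add
    ((ind_int P n hn _).smul _)).add ((ind_int P n hn _).smul _)

lemma delta_cond (P : VSIProcess α q Ω) (n : ℕ) (hn : 1 ≤ n) :
    P.μ[fun ω => X P (n+1) ω - X P n ω | P.F n] =ᵐ[P.μ]
      fun ω => (1 + α - 2 * q) * (X P n ω / (Zvs α n * n)) := by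
  have i1 := (ind_int P n hn (1,1)).smul (1 + α)
  have i2 := (ind_int P n hn (-1,1)).smul (-1 + α)
  have i3 := (ind_int P n hn (1,-1)).smul (1 - α)
  have i4 := (ind_int P n hn (-1,-1)).smul (-1 - α)
  rw [delta_eq P n hn]
  filter_upwards [condExp_add ((i1.add i2).add i3) i4 (P.F n), condExp_add (i1.add i2) i3 (P.F n),
    condExp_add i1 i2 (P.F n), condExp_smul (μ := P.μ) (1 + α)
      (Set.indicator {ω | P.Δ (n + 1) ω - P.Δ n ω = (1, 1)} (fun _ => (1 : ℝ))) (P.F n),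
    condExp_smul (μ := P.μ) (-1 + α)
      (Set.indicator {ω | P.Δ (n + 1) ω - P.Δ n ω = (-1, 1)} (fun _ => (1 : ℝ))) (P.F n),
    condExp_smul (μ := P.μ) (1 - α)
      (Set.indicator {ω | P.Δ (n + 1) ω - P.Δ n ω = (1, -1)} (fun _ => (1 : ℝ))) (P.F n),
    condExp_smul (μ := P.μ) (-1 - α)
      (Set.indicator {ω | P.Δ (n + 1) ω - P.Δ n ω = (-1, -1)} (fun _ => (1 : ℝ))) (P.F n),
    P.cond_rr n hn, P.cond_br n hn, P.cond_rb n hn, P.cond_bb n hn]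
    with ω h1 h2 h3 h4 h5 h6 h7 h8 h9 h10 h11
  rw [h1, Pi.add_apply, h2, Pi.add_apply, h3, Pi.add_apply, h4, h5, h6, h7]
  simp only [Pi.smul_apply, smul_eq_mul]
  rw [h8, h9, h10, h11]
  unfold pvs X
  ring

/-- `h` bounded and `F n`-measurable: integrals against the increment and its drift agree. -/
lemma mart (P : VSIProcess α q Ω) (n : ℕ) (hn : 1 ≤ n) (h : Ω → ℝ) (C : ℝ)
    (hm : Measurable[P.F n] h) (hb : ∀ ω, |h ω| ≤ C) :
    Integrable (fun ω => h ω * ((X P (n+1) ω - X P n ω)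
      - (1 + α - 2 * q) * (X P n ω / (Zvs α n * n)))) P.μ ∧
    ∫ ω, h ω * ((X P (n+1) ω - X P n ω)
      - (1 + α - 2 * q) * (X P n ω / (Zvs α n * n))) ∂P.μ = 0 := by
  have := P.isProb
  have hd := delta_int P n hn
  have hsm : StronglyMeasurable[P.F n] h := hm.stronglyMeasurable
  have hint : Integrable (h * fun ω => X P (n+1) ω - X P n ω) P.μ :=
    hd.bdd_mul (hsm.mono (P.F_le n)).aestronglyMeasurable (Eventually.of_forall hb)
  have hc := condExp_mul_of_stronglyMeasurable_left hsm hint hd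
  have hce : P.μ[h * fun ω => X P (n+1) ω - X P n ω | P.F n] =ᵐ[P.μ]
      fun ω => h ω * ((1 + α - 2 * q) * (X P n ω / (Zvs α n * n))) := by
    filter_upwards [hc, delta_cond P n hn] with ω h1 h2
    rw [h1, Pi.mul_apply, h2]
  have hint2 := (integrable_condExp (m := P.F n) (μ := P.μ)
    (f := h * fun ω => X P (n+1) ω - X P n ω)).congr hce
  have e : (fun ω => h ω * ((X P (n+1) ω - X P n ω)
      - (1 + α - 2 * q) * (X P n ω / (Zvs α n * n)))) =
      fun ω => (h * fun ω => X P (n+1) ω - X P n ω) ω -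
        h ω * ((1 + α - 2 * q) * (X P n ω / (Zvs α n * n))) := by
    funext ω; simp only [Pi.mul_apply]; ring
  rw [e]
  refine ⟨hint.sub hint2, ?_⟩
  rw [integral_sub hint hint2, ← integral_congr_ae hce, integral_condExp (P.F_le n), sub_self]

/-- The process has been above the high barrier up to time `n`. -/
def High (P : VSIProcess α q Ω) (A : ℝ) (n : ℕ) : Set Ω :=
  {ω | ∃ m : ℕ, 1 ≤ m ∧ m ≤ n ∧ A * Zvs α m * Real.sqrt m < X P m ω}

/-- The process has been below the low barrier after being high, up to time `n`. -/
def Hit (P : VSIProcess α q Ω) (A B : ℝ) (n : ℕ) : Set Ω :=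
  {ω | ∃ m k : ℕ, 1 ≤ m ∧ m < k ∧ k ≤ n ∧ A * Zvs α m * Real.sqrt m < X P m ω ∧
    X P k ω ≤ B * Zvs α k * Real.sqrt k}

lemma A_meas (P : VSIProcess α q Ω) (n m : ℕ) (hm : 1 ≤ m) (hmn : m ≤ n) (c : ℝ) :
    MeasurableSet[P.F n] {ω | c < X P m ω} :=
  P.F_mono hmn _ ((X_meas P m hm) measurableSet_Ioi)

lemma High_meas (P : VSIProcess α q Ω) (A : ℝ) (n : ℕ) : MeasurableSet[P.F n] (High P A n) := by
  have : High P A n = ⋃ m : ℕ, ⋃ _ : 1 ≤ m, ⋃ _ : m ≤ n,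
      {ω | A * Zvs α m * Real.sqrt m < X P m ω} := by
    ext ω; simp only [High, Set.mem_iUnion, Set.mem_ofPred_eq, exists_prop]
  rw [this]
  exact MeasurableSet.iUnion fun m => MeasurableSet.iUnion fun h1 => MeasurableSet.iUnion fun h2 =>
    A_meas P n m h1 h2 _

lemma Hit_meas (P : VSIProcess α q Ω) (A B : ℝ) (n : ℕ) :
    MeasurableSet[P.F n] (Hit P A B n) := by
  have : Hit P A B n = ⋃ m : ℕ, ⋃ k : ℕ, ⋃ _ : 1 ≤ m, ⋃ _ : m < k, ⋃ _ : k ≤ n,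
      ({ω | A * Zvs α m * Real.sqrt m < X P m ω} ∩
        {ω | B * Zvs α k * Real.sqrt k < X P k ω}ᶜ) := by
    ext ω; simp only [Hit, Set.mem_iUnion, Set.mem_ofPred_eq, exists_prop, Set.mem_inter_iff,
      Set.mem_compl_iff, not_lt]
  rw [this]
  exact MeasurableSet.iUnion fun m => MeasurableSet.iUnion fun k => MeasurableSet.iUnion fun h1 =>
    MeasurableSet.iUnion fun h2 => MeasurableSet.iUnion fun h3 =>
    (A_meas P n m h1 (h2.le.trans h3) _).inter (A_meas P n k (h1.trans h2.le) h3 _).compl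

lemma tauLow_iff (P : VSIProcess α q Ω) (A B : ℝ) (N : ℕ) :
    {ω | tauLow P A B ω ≤ (N : ℕ∞)} ⊆ Hit P A B N := by
  intro ω hω
  have hlt : tauLow P A B ω < ((N + 1 : ℕ) : ℕ∞) :=
    lt_of_le_of_lt hω (by exact_mod_cast Nat.lt_succ_self N)
  unfold tauLow at hlt
  rw [sInf_lt_iff] at hlt
  obtain ⟨_, ⟨k, rfl, hk, hlow⟩, hkN⟩ := hlt
  unfold tauHigh at hk
  rw [sInf_lt_iff] at hk
  obtain ⟨_, ⟨m, rfl, hm, hhigh⟩, hmk⟩ := hk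
  have h1 : k < N + 1 := by exact_mod_cast hkN
  have h2 : m < k := by exact_mod_cast hmk
  exact ⟨m, k, hm, h2, by omega, hhigh, hlow⟩

open Classical in
/-- The potential (a supermartingale). -/
noncomputable def V (P : VSIProcess α q Ω) (A B : ℝ) (n : ℕ) (ω : Ω) : ℝ :=
  if ω ∈ Hit P A B n then 1 / B^2 else
    if ω ∈ High P A n then (Zvs α n)^2 * n / (X P n ω)^2 else 1 / A^2

lemma V_meas (P : VSIProcess α q Ω) (A B : ℝ) (n : ℕ) (hn : 1 ≤ n) :
    Measurable[P.F n] (V P A B n) := by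
  classical
  have hX := X_meas P n hn
  unfold V
  refine Measurable.ite (Hit_meas P A B n) ?_ ?_
  · exact measurable_const
  refine Measurable.ite (High_meas P A n) ?_ ?_
  · exact (hX.pow_const 2).const_div _
  · exact measurable_const

lemma alive_gt (P : VSIProcess α q Ω) (hα : -(1/2) ≤ α) (A B : ℝ) (hAB : B ≤ A) (n : ℕ)
    (ω : Ω) (h1 : ω ∉ Hit P A B n) (h2 : ω ∈ High P A n) :
    B * Zvs α n * Real.sqrt n < X P n ω := by
  obtain ⟨m, hm, hmn, h⟩ := h2
  rcases hmn.eq_or_lt with rfl | hlt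
  · have := Z_ge α hα m hm
    refine lt_of_le_of_lt ?_ h
    gcongr
  · by_contra hcon
    exact h1 ⟨m, n, hm, hlt, le_rfl, h, not_lt.mp hcon⟩

lemma f_le (hα : -(1/2) ≤ α) (B x : ℝ) (hB : 0 < B) (n : ℕ) (hn : 1 ≤ n)
    (hx : B * Zvs α n * Real.sqrt n < x) : (Zvs α n)^2 * n / x^2 ≤ 1 / B^2 := by
  have hZ := Z_ge α hα n hn
  have hN : (1:ℝ) ≤ n := by exact_mod_cast hn
  have h0 : 0 < B * Zvs α n * Real.sqrt n := by positivity
  have h1 : (B * Zvs α n * Real.sqrt n)^2 = B^2 * ((Zvs α n)^2 * n) := by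
    rw [mul_pow, Real.sq_sqrt (by linarith)]; ring
  have h2 : (B * Zvs α n * Real.sqrt n)^2 ≤ x^2 := by gcongr
  rw [div_le_div_iff₀ (by nlinarith) (by positivity)]
  linarith

lemma f_ge (B x : ℝ) (hB : 0 < B) (n : ℕ) (hx0 : 0 < x)
    (hx : x ≤ B * Zvs α n * Real.sqrt n) : 1 / B^2 ≤ (Zvs α n)^2 * n / x^2 := by
  have h1 : (B * Zvs α n * Real.sqrt n)^2 = B^2 * ((Zvs α n)^2 * n) := by
    rw [mul_pow, Real.sq_sqrt (by positivity)]; ring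
  have h2 : x^2 ≤ (B * Zvs α n * Real.sqrt n)^2 := by gcongr
  rw [div_le_div_iff₀ (by positivity) (by positivity)]
  linarith

lemma V_nonneg (P : VSIProcess α q Ω) (A B : ℝ) (n : ℕ) (ω : Ω) : 0 ≤ V P A B n ω := by
  unfold V; split_ifs <;> positivity

lemma V_le (P : VSIProcess α q Ω) (hα : -(1/2) ≤ α) (A B : ℝ) (hB : 0 < B) (hAB : B ≤ A) (n : ℕ)
    (hn : 1 ≤ n) (ω : Ω) : V P A B n ω ≤ 1 / B^2 := by
  unfold V
  split_ifs with h1 h2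
  · exact le_rfl
  · exact f_le hα B _ hB n hn (alive_gt P hα A B hAB n ω h1 h2)
  · gcongr

lemma V_int (P : VSIProcess α q Ω) (hα : -(1/2) ≤ α) (A B : ℝ) (hB : 0 < B) (hAB : B ≤ A) (n : ℕ)
    (hn : 1 ≤ n) : Integrable (V P A B n) P.μ := by
  have := P.isProb
  refine Integrable.of_bound
    ((V_meas P A B n hn).mono (P.F_le n) le_rfl).aestronglyMeasurable (1 / B^2)
    (Eventually.of_forall fun ω => ?_)
  rw [Real.norm_eq_abs, abs_of_nonneg (V_nonneg P A B n ω)]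
  exact V_le P hα A B hB hAB n hn ω

open Classical in
/-- The multiplier in the supermartingale step. -/
noncomputable def hm (P : VSIProcess α q Ω) (A B : ℝ) (n : ℕ) (ω : Ω) : ℝ :=
  if ω ∈ High P A n \ Hit P A B n then
    -2 * ((Zvs α (n+1))^2 * ((n:ℝ)+1)) / (X P n ω)^3 else 0

lemma V_step (P : VSIProcess α q Ω) (hα : -(1/2) ≤ α) (A B : ℝ) (hq0 : 0 ≤ q)
    (hq : q * (16 * (2 + α)^2) ≤ 1) (hBdef : B = 8 * (1 + |α|) * (2 + α))
    (hB : 0 < B) (hAB : B ≤ A) (n : ℕ) (hn : 1 ≤ n) (ω : Ω) :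
    V P A B (n+1) ω ≤ V P A B n ω + hm P A B n ω * ((X P (n+1) ω - X P n ω)
      - (1 + α - 2 * q) * (X P n ω / (Zvs α n * n))) := by
  have hHit : ω ∈ Hit P A B n → ω ∈ Hit P A B (n+1) := fun ⟨m, k, a, b, c, d⟩ =>
    ⟨m, k, a, b, by omega, d⟩
  have hHigh : ω ∈ High P A n → ω ∈ High P A (n+1) := fun ⟨m, a, b, c⟩ => ⟨m, a, by omega, c⟩
  by_cases h1 : ω ∈ Hit P A B n
  · simp [V, hm, h1, hHit h1]
  by_cases h2 : ω ∈ High P A n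
  · have hs := step α q B (X P n ω) (X P (n+1) ω - X P n ω) n hα hn hq0 hq hBdef
      (alive_gt P hα A B hAB n ω h1 h2) (delta_bound P n hn ω)
    obtain ⟨-, hpos, hle⟩ := hs
    rw [add_sub_cancel] at hpos hle
    have e1 : V P A B n ω = (Zvs α n)^2 * n / (X P n ω)^2 := by simp [V, h1, h2]
    have e2 : hm P A B n ω = -2 * ((Zvs α (n+1))^2 * ((n:ℝ)+1)) / (X P n ω)^3 := by
      simp [hm, h1, h2]
    rw [e1, e2]
    refine le_trans ?_ hle
    by_cases h3 : ω ∈ Hit P A B (n+1)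
    · have e3 : V P A B (n+1) ω = 1 / B^2 := by simp [V, h3]
      rw [e3]
      have hlow : X P (n+1) ω ≤ B * Zvs α (n+1) * Real.sqrt (n+1 : ℕ) := by
        obtain ⟨m, k, a, b, c, d, e⟩ := h3
        rcases c.eq_or_lt with rfl | hlt
        · exact e
        · exact absurd ⟨m, k, a, b, by omega, d, e⟩ h1
      have := f_ge B _ hB (n+1) hpos hlow
      push_cast at this
      exact this
    · have e3 : V P A B (n+1) ω = (Zvs α (n+1))^2 * ((n+1 : ℕ) : ℝ) / (X P (n+1) ω)^2 := by
        simp [V, h3, hHigh h2]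
      rw [e3]; push_cast; exact le_rfl
  · have e1 : V P A B n ω = 1 / A^2 := by simp [V, h1, h2]
    have e2 : hm P A B n ω = 0 := by simp [hm, h2]
    have h3 : ω ∉ Hit P A B (n+1) := by
      rintro ⟨m, k, a, b, c, d, e⟩
      exact h2 ⟨m, a, by omega, d⟩
    rw [e1, e2, zero_mul, add_zero]
    by_cases h4 : ω ∈ High P A (n+1)
    · have e3 : V P A B (n+1) ω = (Zvs α (n+1))^2 * ((n+1 : ℕ) : ℝ) / (X P (n+1) ω)^2 := by
        simp [V, h3, h4]
      rw [e3]
      obtain ⟨m, a, b, c⟩ := h4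
      rcases b.eq_or_lt with rfl | hlt
      · exact f_le hα A _ (by linarith) (n+1) (by omega) c
      · exact absurd ⟨m, a, by omega, c⟩ h2
    · simp [V, h3, h4]

lemma V_integral (P : VSIProcess α q Ω) (hα : -(1/2) ≤ α) (A B : ℝ) (hq0 : 0 ≤ q)
    (hq : q * (16 * (2 + α)^2) ≤ 1) (hBdef : B = 8 * (1 + |α|) * (2 + α))
    (hB : 0 < B) (hAB : B ≤ A) (n : ℕ) (hn : 1 ≤ n) :
    ∫ ω, V P A B n ω ∂P.μ ≤ 1 / A^2 := by
  have := P.isProb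
  induction n, hn using Nat.le_induction with
  | base =>
    have : ∀ ω, V P A B 1 ω ≤ 1 / A^2 := by
      intro ω
      have h3 : ω ∉ Hit P A B 1 := by
        rintro ⟨m, k, a, b, c, d, e⟩
        omega
      by_cases h4 : ω ∈ High P A 1
      · have e3 : V P A B 1 ω = (Zvs α 1)^2 * ((1 : ℕ) : ℝ) / (X P 1 ω)^2 := by
          simp [V, h3, h4]
        rw [e3]
        obtain ⟨m, a, b, c⟩ := h4
        obtain rfl : m = 1 := by omega
        exact f_le hα A _ (by linarith) 1 le_rfl c
      · simp [V, h3, h4]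
    calc ∫ ω, V P A B 1 ω ∂P.μ ≤ ∫ _, 1 / A^2 ∂P.μ :=
          integral_mono (V_int P hα A B hB hAB 1 le_rfl) (integrable_const _) this
      _ = 1 / A^2 := by simp
  | succ n hn ih =>
    classical
    have hmeas : Measurable[P.F n] (hm P A B n) := by
      unfold hm
      refine Measurable.ite
        ((High_meas P A n).diff (Hit_meas P A B n)) ?_ ?_
      · exact ((X_meas P n hn).pow_const 3).const_div _
      · exact measurable_const
    have hbd : ∀ ω, |hm P A B n ω| ≤ 2 * ((Zvs α (n+1))^2 * ((n:ℝ)+1)) := by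
      intro ω
      unfold hm
      split_ifs with h
      · have hs := (step α q B (X P n ω) 0 n hα hn hq0 hq hBdef
          (alive_gt P hα A B hAB n ω h.2 h.1) (by simp; positivity)).1
        have h3 : 1 ≤ (X P n ω)^3 := one_le_pow₀ hs
        rw [abs_div, abs_of_nonneg (by linarith : 0 ≤ (X P n ω)^3), neg_mul, abs_neg,
          abs_of_nonneg (by positivity)]
        exact div_le_self (by positivity) h3
      · simp; positivity
    obtain ⟨hi, h0⟩ := mart P n hn _ _ hmeas hbd
    have hVi := V_int P hα A B hB hAB n hn
    calc ∫ ω, V P A B (n+1) ω ∂P.μ ≤ ∫ ω, (V P A B n ω + hm P A B n ω *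
          ((X P (n+1) ω - X P n ω) - (1 + α - 2 * q) * (X P n ω / (Zvs α n * n)))) ∂P.μ :=
          integral_mono (V_int P hα A B hB hAB (n+1) (by omega)) (hVi.add hi)
            (V_step P hα A B hq0 hq hBdef hB hAB n hn)
      _ = ∫ ω, V P A B n ω ∂P.μ := by rw [integral_add hVi hi, h0, add_zero]
      _ ≤ _ := ih

lemma Hit_prob (P : VSIProcess α q Ω) (hα : -(1/2) ≤ α) (A B : ℝ) (hq0 : 0 ≤ q)
    (hq : q * (16 * (2 + α)^2) ≤ 1) (hBdef : B = 8 * (1 + |α|) * (2 + α))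
    (hB : 0 < B) (hAB : B ≤ A) (n : ℕ) (hn : 1 ≤ n) :
    P.μ.real (Hit P A B n) ≤ B^2 / A^2 := by
  have := P.isProb
  have h := V_integral P hα A B hq0 hq hBdef hB hAB n hn
  have hms : MeasurableSet (Hit P A B n) := P.F_le n _ (Hit_meas P A B n)
  have h2 : P.μ.real (Hit P A B n) * (1 / B^2) ≤ ∫ ω, V P A B n ω ∂P.μ := by
    rw [← smul_eq_mul, ← integral_indicator_const _ hms]
    refine integral_mono ((integrable_const _).indicator hms) (V_int P hα A B hB hAB n hn) ?_
    intro ω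
    by_cases hω : ω ∈ Hit P A B n
    · simp [V, hω]
    · simpa [hω] using V_nonneg P A B n ω
  have h3 := h2.trans h
  rw [mul_one_div, div_le_iff₀ (by positivity)] at h3
  calc _ ≤ _ := h3
    _ = _ := by ring

end VSIaux

/-- For very simple increasing trees and `γ ∈ (0, 1/2)` there are `B > 1` and `q₀ ∈ (0,1)`
such that for all `q ∈ (0, q₀)` and all `N ≥ 1`, with `A = q^(γ-1/2)`,
`μ(τ_low(B) ≤ N) ≤ B²(α+2)² q^(1-2γ)`. -/
theorem vsi_tauLow_bound (α : ℝ) (hα : α ∈ vsiAllowed)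
    (γ : ℝ) (hγ0 : 0 < γ) (hγ : γ < 1 / 2) :
    ∃ B q₀ : ℝ, 1 < B ∧ 0 < q₀ ∧ q₀ < 1 ∧
      ∀ q : ℝ, 0 < q → q < q₀ →
        ∀ (Ω : Type) [MeasurableSpace Ω] (P : VSIProcess α q Ω),
          ∀ N : ℕ, 1 ≤ N →
            (P.μ {ω | tauLow P (q ^ (γ - 1 / 2)) B ω ≤ (N : ℕ∞)}).toReal ≤
              B ^ 2 * (α + 2) ^ 2 * q ^ (1 - 2 * γ) := by
  have hα2 : -(1/2) ≤ α := by
    rcases hα with ⟨d, hd, rfl⟩ | h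
    · have hd' : (2:ℝ) ≤ d := by exact_mod_cast hd
      rw [neg_div, neg_le_neg_iff]
      gcongr
    · have : 0 ≤ α := h
      linarith
  have hpos : 0 < 2 + α := by linarith
  have hB12 : 1 < 8 * (1 + |α|) * (2 + α) := by nlinarith [abs_nonneg α]
  refine ⟨8 * (1 + |α|) * (2 + α), 1 / (16 * (2 + α)^2), hB12, by positivity, ?_, ?_⟩
  · rw [div_lt_one (by positivity)]; nlinarith
  intro q hq0 hq Ω _ P N hN
  have := P.isProb
  obtain ⟨B, hB⟩ : ∃ B, B = 8 * (1 + |α|) * (2 + α) := ⟨_, rfl⟩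
  rw [← hB] at hB12 ⊢
  have hq' : q * (16 * (2 + α)^2) ≤ 1 := by
    rw [lt_div_iff₀ (by positivity)] at hq; exact hq.le
  have hA0 : 0 < q ^ (γ - 1/2) := Real.rpow_pos_of_pos hq0 _
  have hA2 : q ^ (1 - 2 * γ) = 1 / (q ^ (γ - 1/2))^2 := by
    rw [← Real.rpow_natCast, ← Real.rpow_mul hq0.le, one_div, ← Real.rpow_neg hq0.le]
    congr 1; push_cast; ring
  rw [hA2]
  have h1 : 1 ≤ (α + 2)^2 := by nlinarith
  have key : (P.μ {ω | tauLow P (q ^ (γ - 1 / 2)) B ω ≤ (N : ℕ∞)}).toReal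
      ≤ B^2 / (q ^ (γ - 1/2))^2 := by
    rcases le_total B (q ^ (γ - 1/2)) with hAB | hAB
    · refine le_trans ?_ (VSIaux.Hit_prob P hα2 _ B hq0.le hq' hB (by linarith) hAB N hN)
      exact measureReal_mono (VSIaux.tauLow_iff P _ B N)
    · refine le_trans (measureReal_le_one (μ := P.μ)) ?_
      rw [one_le_div (by positivity)]
      gcongr
  refine key.trans ?_
  rw [mul_one_div]
  gcongr
  nlinarith [sq_nonneg B]
end

section
/- Let α ∈ {−1/d : d ∈ ℕ, d ≥ 2} ∪ [0,∞), γ ∈ (0, 1/2), q ∈ (0, 1], and let (Δ(n))_{n≥1} be a very simple increasing color-difference process with parameters (α, q). Set A := q^{γ − 1/2}. Then for every integer N with N ≥ A² + 1: μ( τ_high(A) > N ) ≤ q^{2γ}. -/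
open MeasureTheory Filter
open scoped ENat


/-- The process has never mutated up to time `n`. -/
def vsiGood {α q : ℝ} {Ω : Type} [MeasurableSpace Ω] (P : VSIProcess α q Ω) (n : ℕ) : Set Ω :=
  {ω | P.Δ n ω = ((n : ℤ), (n : ℤ) - 1)}

lemma vsi_alpha_ge {α : ℝ} (hα : α ∈ vsiAllowed) : -(1 / 2) ≤ α := by
  rcases hα with ⟨d, hd, rfl⟩ | h
  · have hd' : (2 : ℝ) ≤ d := by exact_mod_cast hd
    have h0 : (0 : ℝ) < d := by linarith
    rw [le_div_iff₀ h0]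
    linarith
  · have : (0 : ℝ) ≤ α := h
    linarith

lemma Zvs_mul {α : ℝ} {n : ℕ} (hn : 1 ≤ n) :
    Zvs α n * (n : ℝ) = (n : ℝ) + α * ((n : ℝ) - 1) := by
  have h0 : (n : ℝ) ≠ 0 := by positivity
  unfold Zvs
  field_simp
  ring

lemma Zvs_pos {α : ℝ} (hα : α ∈ vsiAllowed) {n : ℕ} (hn : 1 ≤ n) : 0 < Zvs α n := by
  have ha := vsi_alpha_ge hα
  have h1 : (1 : ℝ) ≤ n := by exact_mod_cast hn
  have h0 : (0 : ℝ) < n := by linarith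
  have h := Zvs_mul (α := α) hn
  have : 0 < Zvs α n * (n : ℝ) := by rw [h]; nlinarith
  exact pos_of_mul_pos_left this h0.le

lemma pvs_good {α : ℝ} (hα : α ∈ vsiAllowed) {n : ℕ} (hn : 1 ≤ n) :
    pvs α n (n : ℤ) ((n : ℤ) - 1) = 1 := by
  have h0 : (0 : ℝ) < n := by exact_mod_cast hn
  have hW : 0 < Zvs α n * (n : ℝ) := mul_pos (Zvs_pos hα hn) h0
  unfold pvs
  push_cast
  rw [← Zvs_mul hn, div_self hW.ne']
  norm_num

lemma vsiGood_meas {α q : ℝ} {Ω : Type} [MeasurableSpace Ω] (P : VSIProcess α q Ω) {n : ℕ}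
    (hn : 1 ≤ n) : MeasurableSet[P.F n] (vsiGood P n) :=
  P.adapted n hn (measurableSet_singleton ((n : ℤ), (n : ℤ) - 1))

lemma vsiGood_step {α : ℝ} (hα : α ∈ vsiAllowed) {q : ℝ} {Ω : Type} [MeasurableSpace Ω]
    (P : VSIProcess α q Ω) {n : ℕ} (hn : 1 ≤ n) :
    (1 - q) * P.μ.real (vsiGood P n) ≤ P.μ.real (vsiGood P (n + 1)) := by
  haveI := P.isProb
  have hG := vsiGood_meas P hn
  have hG' := P.F_le n _ hG
  set E : Set Ω := {ω | P.Δ (n + 1) ω - P.Δ n ω = (1, 1)} with hE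
  have hEm : MeasurableSet E :=
    P.F_le (n + 1) _ (P.D_meas n hn (measurableSet_singleton ((1 : ℤ), (1 : ℤ))))
  have hint : Integrable (Set.indicator E (fun _ => (1 : ℝ))) P.μ :=
    (integrable_const (1 : ℝ)).indicator hEm
  have h1 : ∫ ω in vsiGood P n, (P.μ[Set.indicator E (fun _ => (1 : ℝ)) | P.F n]) ω ∂P.μ
      = ∫ ω in vsiGood P n, Set.indicator E (fun _ => (1 : ℝ)) ω ∂P.μ :=
    setIntegral_condExp (P.F_le n) hint hG
  have h2 : ∫ ω in vsiGood P n, (P.μ[Set.indicator E (fun _ => (1 : ℝ)) | P.F n]) ω ∂P.μ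
      = ∫ ω in vsiGood P n, (1 - q) ∂P.μ := by
    apply setIntegral_congr_ae hG'
    filter_upwards [P.cond_rr n hn] with ω hω hg
    rw [hω]
    have hg' : P.Δ n ω = ((n : ℤ), (n : ℤ) - 1) := hg
    rw [hg']
    simp only
    rw [pvs_good hα hn, one_mul]
  have h3 : ∫ ω in vsiGood P n, Set.indicator E (fun _ => (1 : ℝ)) ω ∂P.μ
      = P.μ.real (vsiGood P n ∩ E) := by
    rw [setIntegral_indicator hEm]
    simp
  have h4 : ∫ ω in vsiGood P n, (1 - q) ∂P.μ = (1 - q) * P.μ.real (vsiGood P n) := by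
    rw [setIntegral_const, smul_eq_mul, mul_comm]
  rw [← h4, ← h2, h1, h3]
  apply measureReal_mono _ (measure_ne_top _ _)
  rintro ω ⟨hg, he⟩
  have hg' : P.Δ n ω = ((n : ℤ), (n : ℤ) - 1) := hg
  have he' : P.Δ (n + 1) ω - P.Δ n ω = (1, 1) := he
  have : P.Δ (n + 1) ω = (1, 1) + P.Δ n ω := by rw [← he']; abel
  change P.Δ (n + 1) ω = _
  rw [this, hg']
  ext <;> simp <;> ring

lemma vsiGood_bound {α : ℝ} (hα : α ∈ vsiAllowed) {q : ℝ} (hq0 : 0 < q) {Ω : Type}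
    [MeasurableSpace Ω] (P : VSIProcess α q Ω) (m : ℕ) :
    1 - m * q ≤ P.μ.real (vsiGood P (m + 1)) := by
  haveI := P.isProb
  induction m with
  | zero =>
    have : vsiGood P (0 + 1) = Set.univ := by
      ext ω
      simp [vsiGood, P.init ω]
    rw [this]
    simp
  | succ m ih =>
    have h := vsiGood_step hα P (n := m + 1) (by omega)
    have h1 : P.μ.real (vsiGood P (m + 1)) ≤ 1 := measureReal_le_one
    push_cast
    nlinarith

/-- For very simple increasing trees, `γ ∈ (0,1/2)`, `q ∈ (0,1]` and `A = q^(γ-1/2)`: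
for every integer `N ≥ A² + 1`, `μ(τ_high(A) > N) ≤ q^(2γ)`. -/
theorem vsi_tauHigh_bound (α : ℝ) (hα : α ∈ vsiAllowed)
    (γ : ℝ) (hγ0 : 0 < γ) (hγ : γ < 1 / 2)
    (q : ℝ) (hq0 : 0 < q) (hq1 : q ≤ 1)
    (Ω : Type) [MeasurableSpace Ω] (P : VSIProcess α q Ω)
    (N : ℕ) (hN : (q ^ (γ - 1 / 2)) ^ 2 + 1 ≤ (N : ℝ)) :
    (P.μ {ω | (N : ℕ∞) < tauHigh P (q ^ (γ - 1 / 2)) ω}).toReal ≤ q ^ (2 * γ) := by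
  haveI := P.isProb
  set A : ℝ := q ^ (γ - 1 / 2) with hA
  have hA0 : 0 < A := Real.rpow_pos_of_pos hq0 _
  set m : ℕ := ⌊A ^ 2⌋₊ with hm
  have hm1 : (m : ℝ) ≤ A ^ 2 := Nat.floor_le (by positivity)
  have hm2 : A ^ 2 < (m : ℝ) + 1 := Nat.lt_floor_add_one _
  have hmN : m + 1 ≤ N := by
    have : ((m + 1 : ℕ) : ℝ) ≤ N := by push_cast; linarith
    exact_mod_cast this
  have hsub : {ω | (N : ℕ∞) < tauHigh P A ω} ⊆ (vsiGood P (m + 1))ᶜ := by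
    intro ω hω hg
    have hg' : P.Δ (m + 1) ω = (((m + 1 : ℕ) : ℤ), ((m + 1 : ℕ) : ℤ) - 1) := hg
    have hω' : (N : ℕ∞) < tauHigh P A ω := hω
    have hle : tauHigh P A ω ≤ ((m + 1 : ℕ) : ℕ∞) := by
      apply sInf_le
      refine ⟨m + 1, rfl, by omega, ?_⟩
      rw [hg']
      have hZ := Zvs_pos hα (n := m + 1) (by omega)
      have hmul := Zvs_mul (α := α) (n := m + 1) (by omega)
      have hpos : (0 : ℝ) ≤ ((m + 1 : ℕ) : ℝ) := by positivity
      have hs : A < Real.sqrt ((m + 1 : ℕ) : ℝ) := by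
        apply Real.lt_sqrt_of_sq_lt
        push_cast
        exact hm2
      have hss := Real.mul_self_sqrt hpos
      have hs0 : 0 < Real.sqrt ((m + 1 : ℕ) : ℝ) := hA0.trans hs
      have e : (((((m + 1 : ℕ) : ℤ), ((m + 1 : ℕ) : ℤ) - 1) : ℤ × ℤ).1 : ℝ)
          + α * (((((m + 1 : ℕ) : ℤ), ((m + 1 : ℕ) : ℤ) - 1) : ℤ × ℤ).2 : ℝ)
          = Zvs α (m + 1) * ((m + 1 : ℕ) : ℝ) := by
        rw [hmul]; push_cast; ring
      rw [e]
      calc A * Zvs α (m + 1) * Real.sqrt ((m + 1 : ℕ) : ℝ)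
          < Real.sqrt ((m + 1 : ℕ) : ℝ) * Zvs α (m + 1) * Real.sqrt ((m + 1 : ℕ) : ℝ) := by
            gcongr
        _ = Zvs α (m + 1) * (Real.sqrt ((m + 1 : ℕ) : ℝ) * Real.sqrt ((m + 1 : ℕ) : ℝ)) := by
            ring
        _ = _ := by rw [hss]
    have h2 : ((m + 1 : ℕ) : ℕ∞) ≤ (N : ℕ∞) := by exact_mod_cast hmN
    exact absurd hω' (not_lt.mpr (hle.trans h2))
  have hb := vsiGood_bound hα hq0 P m
  have hmeas : MeasurableSet (vsiGood P (m + 1)) :=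
    P.F_le (m + 1) _ (vsiGood_meas P (by omega))
  have hAq : A ^ 2 * q = q ^ (2 * γ) := by
    rw [hA, ← Real.rpow_natCast, ← Real.rpow_mul hq0.le]
    nth_rewrite 2 [← Real.rpow_one q]
    rw [← Real.rpow_add hq0]
    congr 1
    push_cast
    ring
  calc (P.μ {ω | (N : ℕ∞) < tauHigh P A ω}).toReal
      ≤ P.μ.real (vsiGood P (m + 1))ᶜ := measureReal_mono hsub (measure_ne_top _ _)
    _ = 1 - P.μ.real (vsiGood P (m + 1)) := probReal_compl_eq_one_sub hmeas
    _ ≤ m * q := by linarith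
    _ ≤ A ^ 2 * q := by gcongr
    _ = q ^ (2 * γ) := hAq
end
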